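/- Let M be an L-structure and d a Turing degree. Then Th(M) is d-computable if and only if ⌜Th(M)⌝ is Π₁^d. -/

import Mathlib

/-!
Self-contained framework: oracle computability, the jump, the ω-jump,
and the relativized arithmetical hierarchy.
-/

open scoped Classical

namespace CLPaper

/-- Codes for oracle (partial recursive in an oracle) computations.  This mirrors
`Nat.Partrec.Code` with an extra constructor for querying the oracle. -/
inductive OCode : Type
  | zero : OCode
  | succ : OCode
  | left : OCode
  | right : OCode
  | oracle : OCode
  | pair : OCode → OCode → OCode
  | comp : OCode → OCode → OCode
  | prec : OCode → OCode → OCode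
  | rfind' : OCode → OCode

/-- Evaluation of an oracle code relative to an oracle `O : ℕ → Bool`. -/
def OCode.eval (O : ℕ → Bool) : OCode → ℕ →. ℕ
  | .zero => pure 0
  | .succ => fun n => Part.some (n + 1)
  | .left => fun n => Part.some n.unpair.1
  | .right => fun n => Part.some n.unpair.2
  | .oracle => fun n => Part.some (Bool.toNat (O n))
  | .pair cf cg => fun n => Nat.pair <$> OCode.eval O cf n <*> OCode.eval O cg n
  | .comp cf cg => fun n => OCode.eval O cg n >>= OCode.eval O cf
  | .prec cf cg =>
      Nat.unpaired fun a n =>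
        n.rec (OCode.eval O cf a) fun y IH => do
          let i ← IH
          OCode.eval O cg (Nat.pair a (Nat.pair y i))
  | .rfind' cf =>
      Nat.unpaired fun a m =>
        (Nat.rfind fun n => (fun x => x = 0) <$> OCode.eval O cf (Nat.pair a (n + m))).map (· + m)

/-- A concrete Gödel numbering of oracle codes. -/
def OCode.gnum : OCode → ℕ
  | .zero => 0
  | .succ => 1
  | .left => 2
  | .right => 3
  | .oracle => 4
  | .pair a b => 5 + 4 * Nat.pair a.gnum b.gnum
  | .comp a b => 6 + 4 * Nat.pair a.gnum b.gnum
  | .prec a b => 7 + 4 * Nat.pair a.gnum b.gnum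
  | .rfind' a => 8 + 4 * a.gnum

/-- `f` is (partial) recursive in the oracle `O`. -/
def RecursiveIn (O : ℕ → Bool) (f : ℕ →. ℕ) : Prop :=
  ∃ c : OCode, c.eval O = f

/-- A total function is computable in the oracle `O`. -/
def ComputableIn (O : ℕ → Bool) (f : ℕ → ℕ) : Prop :=
  RecursiveIn O fun n => Part.some (f n)

/-- A set of natural numbers is computable in (Turing reducible to) the oracle `O`. -/
def SetComputableIn (O : ℕ → Bool) (A : Set ℕ) : Prop :=
  ∃ f : ℕ → ℕ, ComputableIn O f ∧ ∀ n, n ∈ A ↔ f n = 1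

/-- The Turing jump of an oracle: (the characteristic function of) the halting problem
relative to the oracle. -/
noncomputable def jump (O : ℕ → Bool) : ℕ → Bool := fun n =>
  decide (∃ c : OCode, c.gnum = n.unpair.1 ∧ ((c.eval O) n.unpair.2).Dom)

/-- Finite iterates of the jump. -/
noncomputable def jumpIter (O : ℕ → Bool) : ℕ → (ℕ → Bool)
  | 0 => O
  | n + 1 => jump (jumpIter O n)

/-- The ω-jump `d^(ω)` of an oracle, coded as a single oracle. -/
noncomputable def omegaJump (O : ℕ → Bool) : ℕ → Bool := fun k =>
  jumpIter O k.unpair.1 k.unpair.2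

/-- The trivial (computable) oracle, representing the Turing degree `0`. -/
def zeroO : ℕ → Bool := fun _ => false

/-- The relativized arithmetical hierarchy: `SigmaIn O n A` says `A` is `Σ_n^O`
(with `Σ_0^O` meaning `O`-computable). -/
def SigmaIn (O : ℕ → Bool) : ℕ → Set ℕ → Prop
  | 0 => fun A => SetComputableIn O A
  | n + 1 => fun A => ∃ B : Set ℕ, SigmaIn O n Bᶜ ∧ A = {x | ∃ y, Nat.pair x y ∈ B}

/-- `A` is `Π_n^O`. -/
def PiIn (O : ℕ → Bool) (n : ℕ) (A : Set ℕ) : Prop :=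
  SigmaIn O n Aᶜ

/-- `A` is arithmetical in `O`. -/
def ArithmeticalIn (O : ℕ → Bool) (A : Set ℕ) : Prop :=
  ∃ n, SigmaIn O n A

end CLPaper

/-!
Continuous first-order logic: restricted formulae, Gödel numbering, semantics.
-/

namespace CLPaper

/-- A continuous first-order language: an arity function for the (ℕ-indexed) function
symbols and one for the predicate symbols (`none` means "not a symbol of `L`"). -/
structure CLang where
  funcArity : ℕ → Option ℕ
  predArity : ℕ → Option ℕ

/-- A computable continuous language. -/
def CLang.IsComputable (L : CLang) : Prop :=
  ComputableIn zeroO (fun n => Encodable.encode (L.funcArity n)) ∧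
    ComputableIn zeroO (fun n => Encodable.encode (L.predArity n))

/-- Terms of a continuous language (symbols indexed by ℕ; well-formedness is a
separate predicate). -/
inductive Term : Type
  | var : ℕ → Term
  | func : ℕ → List Term → Term

/-- Gödel numbering of terms. -/
def Term.godel : Term → ℕ
  | .var n => Nat.pair 0 n
  | .func f args => Nat.pair 1 (Nat.pair f (Encodable.encode (args.attach.map fun t => Term.godel t.1)))
decreasing_by
  have := List.sizeOf_lt_of_mem t.2
  simp only [Term.func.sizeOf_spec]
  omega

/-- Substituting terms for all variables simultaneously. -/
def Term.substAll (σ : ℕ → Term) : Term → Term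
  | .var n => σ n
  | .func f args => .func f (args.attach.map fun t => Term.substAll σ t.1)
decreasing_by
  have := List.sizeOf_lt_of_mem t.2
  simp only [Term.func.sizeOf_spec]
  omega

/-- Substituting a term for a single variable. -/
def Term.subst1 (n : ℕ) (s : Term) : Term → Term
  | .var m => if m = n then s else .var m
  | .func f args => .func f (args.attach.map fun t => Term.subst1 n s t.1)
decreasing_by
  have := List.sizeOf_lt_of_mem t.2
  simp only [Term.func.sizeOf_spec]
  omega

/-- Well-formedness of a term with respect to a language. -/
inductive Term.WF (L : CLang) : Term → Prop
  | var (n : ℕ) : Term.WF L (.var n)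
  | func (f : ℕ) (args : List Term) :
      L.funcArity f = some args.length → (∀ t ∈ args, Term.WF L t) → Term.WF L (.func f args)

/-- The variable `n` occurs in the term. -/
inductive Term.HasVar (n : ℕ) : Term → Prop
  | var : Term.HasVar n (.var n)
  | func (f : ℕ) (args : List Term) (t : Term) :
      t ∈ args → Term.HasVar n t → Term.HasVar n (.func f args)

/-- Closed terms. -/
def Term.ClosedT (t : Term) : Prop := ∀ n, ¬ t.HasVar n

/-- Restricted formulae of continuous logic: atomic formulae, the connectives
`0`, `1`, `x ↦ x/2`, `(x,y) ↦ x ∸ y`, and the quantifiers `sup` and `inf`. -/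
inductive Formula : Type
  | pred : ℕ → List Term → Formula
  | dmetric : Term → Term → Formula
  | zero : Formula
  | one : Formula
  | half : Formula → Formula
  | dotminus : Formula → Formula → Formula
  | qsup : ℕ → Formula → Formula
  | qinf : ℕ → Formula → Formula

/-- Gödel numbering of restricted formulae. -/
def Formula.godel : Formula → ℕ
  | .pred P args => Nat.pair 0 (Nat.pair P (Encodable.encode (args.map Term.godel)))
  | .dmetric t s => Nat.pair 1 (Nat.pair t.godel s.godel)
  | .zero => Nat.pair 2 0
  | .one => Nat.pair 3 0
  | .half φ => Nat.pair 4 φ.godel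
  | .dotminus φ ψ => Nat.pair 5 (Nat.pair φ.godel ψ.godel)
  | .qsup n φ => Nat.pair 6 (Nat.pair n φ.godel)
  | .qinf n φ => Nat.pair 7 (Nat.pair n φ.godel)

/-- Well-formedness of a formula with respect to a language. -/
inductive Formula.WF (L : CLang) : Formula → Prop
  | pred (P : ℕ) (args : List Term) :
      L.predArity P = some args.length → (∀ t ∈ args, Term.WF L t) →
        Formula.WF L (.pred P args)
  | dmetric (t s : Term) : Term.WF L t → Term.WF L s → Formula.WF L (.dmetric t s)
  | zero : Formula.WF L .zero
  | one : Formula.WF L .one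
  | half (φ : Formula) : Formula.WF L φ → Formula.WF L (.half φ)
  | dotminus (φ ψ : Formula) :
      Formula.WF L φ → Formula.WF L ψ → Formula.WF L (.dotminus φ ψ)
  | qsup (n : ℕ) (φ : Formula) : Formula.WF L φ → Formula.WF L (.qsup n φ)
  | qinf (n : ℕ) (φ : Formula) : Formula.WF L φ → Formula.WF L (.qinf n φ)

/-- Quantifier-free formulae. -/
inductive Formula.QF : Formula → Prop
  | pred (P : ℕ) (args : List Term) : Formula.QF (.pred P args)
  | dmetric (t s : Term) : Formula.QF (.dmetric t s)
  | zero : Formula.QF .zero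
  | one : Formula.QF .one
  | half (φ : Formula) : Formula.QF φ → Formula.QF (.half φ)
  | dotminus (φ ψ : Formula) : Formula.QF φ → Formula.QF ψ → Formula.QF (.dotminus φ ψ)

/-- Atomic formulae. -/
inductive Formula.Atomic : Formula → Prop
  | pred (P : ℕ) (args : List Term) : Formula.Atomic (.pred P args)
  | dmetric (t s : Term) : Formula.Atomic (.dmetric t s)

/-- Free occurrence of a variable in a formula. -/
inductive Formula.FreeIn (n : ℕ) : Formula → Prop
  | pred (P : ℕ) (args : List Term) (t : Term) :
      t ∈ args → Term.HasVar n t → Formula.FreeIn n (.pred P args)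
  | dmetric_left (t s : Term) : Term.HasVar n t → Formula.FreeIn n (.dmetric t s)
  | dmetric_right (t s : Term) : Term.HasVar n s → Formula.FreeIn n (.dmetric t s)
  | half (φ : Formula) : Formula.FreeIn n φ → Formula.FreeIn n (.half φ)
  | dotminus_left (φ ψ : Formula) : Formula.FreeIn n φ → Formula.FreeIn n (.dotminus φ ψ)
  | dotminus_right (φ ψ : Formula) : Formula.FreeIn n ψ → Formula.FreeIn n (.dotminus φ ψ)
  | qsup (m : ℕ) (φ : Formula) : m ≠ n → Formula.FreeIn n φ → Formula.FreeIn n (.qsup m φ)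
  | qinf (m : ℕ) (φ : Formula) : m ≠ n → Formula.FreeIn n φ → Formula.FreeIn n (.qinf m φ)

/-- Sentences: formulae with no free variables. -/
def Formula.Closed (φ : Formula) : Prop := ∀ n, ¬ φ.FreeIn n

/-- Restricted `L`-sentences. -/
def Formula.IsSentence (L : CLang) (φ : Formula) : Prop :=
  φ.WF L ∧ φ.Closed

/-- Capture-avoiding substitution of a (closed) term for a free variable. -/
def Formula.substVar (n : ℕ) (s : Term) : Formula → Formula
  | .pred P args => .pred P (args.map (Term.subst1 n s))
  | .dmetric t u => .dmetric (t.subst1 n s) (u.subst1 n s)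
  | .zero => .zero
  | .one => .one
  | .half φ => .half (φ.substVar n s)
  | .dotminus φ ψ => .dotminus (φ.substVar n s) (ψ.substVar n s)
  | .qsup m φ => if m = n then .qsup m φ else .qsup m (φ.substVar n s)
  | .qinf m φ => if m = n then .qinf m φ else .qinf m (φ.substVar n s)

/-- A metric structure (interpretation of all symbol codes). -/
structure CStruct (M : Type*) where
  interpFunc : ℕ → List M → M
  interpPred : ℕ → List M → ℝ

/-- Evaluation of terms in a structure, relative to a variable assignment. -/
def Term.eval {M : Type*} (S : CStruct M) (v : ℕ → M) : Term → M
  | .var n => v n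
  | .func f args => S.interpFunc f (args.attach.map fun t => Term.eval S v t.1)
decreasing_by
  have := List.sizeOf_lt_of_mem t.2
  simp only [Term.func.sizeOf_spec]
  omega

/-- The value of a restricted formula in a metric structure under an assignment. -/
noncomputable def Formula.val {M : Type*} [MetricSpace M] (S : CStruct M) :
    Formula → (ℕ → M) → ℝ
  | .pred P args, v => S.interpPred P (args.map (Term.eval S v))
  | .dmetric t s, v => dist (t.eval S v) (s.eval S v)
  | .zero, _ => 0
  | .one, _ => 1
  | .half φ, v => φ.val S v / 2
  | .dotminus φ ψ, v => max (φ.val S v - ψ.val S v) 0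
  | .qsup n φ, v => ⨆ a : M, φ.val S (Function.update v n a)
  | .qinf n φ, v => ⨅ a : M, φ.val S (Function.update v n a)

/-- The value of a sentence. -/
noncomputable def CStruct.sval {M : Type*} [MetricSpace M] [Nonempty M]
    (S : CStruct M) (φ : Formula) : ℝ :=
  φ.val S (fun _ => Classical.arbitrary M)

/-- `S` is a model of the theory `T` (a set of sentences). -/
def CStruct.ModelsT {M : Type*} [MetricSpace M] [Nonempty M]
    (S : CStruct M) (T : Set Formula) : Prop :=
  ∀ φ ∈ T, S.sval φ = 0

/-- The set of Gödel numbers of a theory. -/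
def godelSet (T : Set Formula) : Set ℕ :=
  {k | ∃ φ ∈ T, Formula.godel φ = k}

/-- `⌜Th(M)⌝`: the set of Gödel numbers of restricted `L`-sentences with value `0` in `S`. -/
def thSet (L : CLang) {M : Type*} [MetricSpace M] [Nonempty M] (S : CStruct M) : Set ℕ :=
  {k | ∃ φ : Formula, φ.IsSentence L ∧ φ.godel = k ∧ S.sval φ = 0}

/-- `Th(S)` is computable in the oracle `O`: an `O`-algorithm, given the Gödel number of a
restricted `L`-sentence `σ` and a positive rational `ε`, returns (a code for) a rational
interval of length `< ε` containing `σ^S`. -/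
def ThComputableIn (O : ℕ → Bool) (L : CLang) {M : Type*} [MetricSpace M] [Nonempty M]
    (S : CStruct M) : Prop :=
  ∃ F : ℕ →. ℕ, RecursiveIn O F ∧
    ∀ φ : Formula, φ.IsSentence L → ∀ ε : ℚ, 0 < ε →
      ∃ a b : ℚ, F (Nat.pair φ.godel (Encodable.encode ε)) =
          Part.some (Encodable.encode (a, b)) ∧
        (b : ℝ) - (a : ℝ) < (ε : ℝ) ∧ (a : ℝ) ≤ S.sval φ ∧ S.sval φ ≤ (b : ℝ)

/-- Adjoining a countable set `C = {c_0, c_1, …}` of fresh constant symbols, placed at the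
odd function-symbol codes. -/
def CLang.withConsts (L : CLang) : CLang where
  funcArity n := if n % 2 = 1 then some 0 else L.funcArity n
  predArity := L.predArity

/-- The constant symbol `c_k` of `L(C)`, as a term. -/
def constC (k : ℕ) : Term := .func (2 * k + 1) []

/-- The formula with constant value the dyadic rational `a / 2^m` (for `0 ≤ a ≤ 2^m`),
built from the restricted connectives. -/
def dyF : ℕ → ℕ → Formula
  | a, 0 => if a = 0 then .zero else .one
  | a, m + 1 =>
    if a ≤ 2 ^ m then .half (dyF a m)
    else .dotminus .one (.half (.dotminus .one (dyF (a - 2 ^ m) m)))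

/-- `min` of two `[0,1]`-valued formulae, `φ ∸ (φ ∸ ψ)`. -/
def minF (φ ψ : Formula) : Formula := .dotminus φ (.dotminus φ ψ)

/-- `max` of two `[0,1]`-valued formulae. -/
def maxF (φ ψ : Formula) : Formula :=
  .dotminus .one (minF (.dotminus .one φ) (.dotminus .one ψ))

/-- Prenex classes: `PrenexClass true m φ` says `φ` is a `∀_m`-formula (at most `m`
alternating quantifier blocks, beginning with `sup`); `PrenexClass false m φ` is `∃_m`. -/
inductive PrenexClass : Bool → ℕ → Formula → Prop
  | qf (b : Bool) (m : ℕ) (φ : Formula) : Formula.QF φ → PrenexClass b m φ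
  | supCont (m : ℕ) (n : ℕ) (φ : Formula) :
      PrenexClass true (m + 1) φ → PrenexClass true (m + 1) (.qsup n φ)
  | supStart (m : ℕ) (n : ℕ) (φ : Formula) :
      PrenexClass false m φ → PrenexClass true (m + 1) (.qsup n φ)
  | infCont (m : ℕ) (n : ℕ) (φ : Formula) :
      PrenexClass false (m + 1) φ → PrenexClass false (m + 1) (.qinf n φ)
  | infStart (m : ℕ) (n : ℕ) (φ : Formula) :
      PrenexClass true m φ → PrenexClass false (m + 1) (.qinf n φ)

/-- A presentation of a separable structure: a sequence of special points (the variables of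
terms act as names for the special points) whose generated rational points are dense. -/
def IsPresentation (L : CLang) {M : Type*} [MetricSpace M] (S : CStruct M) (a : ℕ → M) : Prop :=
  DenseRange fun t : {t : Term // t.WF L} => t.1.eval S a

/-- The presentation `a` is computable in the oracle `O`: an `O`-algorithm computes the
distance between any two rational points to within `2^{-k}`, uniformly in codes. -/
def PresentationComputableIn (O : ℕ → Bool) (L : CLang) {M : Type*} [MetricSpace M]
    (S : CStruct M) (a : ℕ → M) : Prop :=
  ∃ F : ℕ →. ℕ, RecursiveIn O F ∧
    ∀ t₁ t₂ : Term, t₁.WF L → t₂.WF L → ∀ k : ℕ,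
      ∃ q : ℚ, F (Nat.pair (Nat.pair t₁.godel t₂.godel) k) =
          Part.some (Encodable.encode q) ∧
        |dist (t₁.eval S a) (t₂.eval S a) - (q : ℝ)| < (1 / 2 : ℝ) ^ k

/-- An embedding of metric structures (relative to the language `L`). -/
def IsCEmbedding (L : CLang) {M N : Type*} [MetricSpace M] [MetricSpace N]
    (S : CStruct M) (S' : CStruct N) (j : M → N) : Prop :=
  (∀ x y : M, dist (j x) (j y) = dist x y) ∧
    (∀ f k, L.funcArity f = some k → ∀ l : List M, l.length = k →
      j (S.interpFunc f l) = S'.interpFunc f (l.map j)) ∧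
    (∀ P k, L.predArity P = some k → ∀ l : List M, l.length = k →
      S.interpPred P l = S'.interpPred P (l.map j))

/-- The theory `T` has the joint embedding property. -/
def HasJEP (L : CLang) (T : Set Formula) : Prop :=
  ∀ (M₁ : Type) [MetricSpace M₁] [Nonempty M₁] (S₁ : CStruct M₁)
    (M₂ : Type) [MetricSpace M₂] [Nonempty M₂] (S₂ : CStruct M₂),
    S₁.ModelsT T → S₂.ModelsT T →
    ∃ (N : Type) (_ : MetricSpace N) (_ : Nonempty N) (S : CStruct N)
      (j₁ : M₁ → N) (j₂ : M₂ → N),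
      S.ModelsT T ∧ IsCEmbedding L S₁ S j₁ ∧ IsCEmbedding L S₂ S j₂

/-- Existential formulae: `inf`-quantified quantifier-free formulae. -/
inductive IsExistentialF : Formula → Prop
  | qf (φ : Formula) : Formula.QF φ → IsExistentialF φ
  | qinf (n : ℕ) (φ : Formula) : IsExistentialF φ → IsExistentialF (.qinf n φ)

/-- `S` is an existentially closed model of the theory `U`. -/
def IsECModel (L : CLang) (U : Set Formula) {M : Type} [MetricSpace M] [Nonempty M]
    (S : CStruct M) : Prop :=
  S.ModelsT U ∧
    ∀ (N : Type) [MetricSpace N] [Nonempty N] (S' : CStruct N) (j : M → N),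
      IsCEmbedding L S S' j → S'.ModelsT U →
      ∀ φ : Formula, φ.WF L → IsExistentialF φ →
        ∀ v : ℕ → M, φ.val S v = φ.val S' (j ∘ v)

/-- The universal theory (the set of universal consequences) of `T`. -/
def UnivTheoryOf (L : CLang) (T : Set Formula) : Set Formula :=
  {σ | σ.IsSentence L ∧ PrenexClass true 1 σ ∧
    ∀ (M : Type) [MetricSpace M] [Nonempty M] (S : CStruct M),
      S.ModelsT T → S.sval σ = 0}

end CLPaper

namespace CLPaper

variable {O : ℕ → Bool}

theorem OCode.exists_eval_eq_code_eval (O : ℕ → Bool) (c : Nat.Partrec.Code) :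
    ∃ c' : OCode, c'.eval O = c.eval := by
  induction c with
  | zero => exact ⟨.zero, rfl⟩
  | succ => exact ⟨.succ, rfl⟩
  | left => exact ⟨.left, rfl⟩
  | right => exact ⟨.right, rfl⟩
  | pair f g hf hg =>
    obtain ⟨a, ha⟩ := hf
    obtain ⟨b, hb⟩ := hg
    exact ⟨.pair a b, by simp only [OCode.eval, Nat.Partrec.Code.eval, ha, hb]; rfl⟩
  | comp f g hf hg =>
    obtain ⟨a, ha⟩ := hf
    obtain ⟨b, hb⟩ := hg
    exact ⟨.comp a b, by simp only [OCode.eval, Nat.Partrec.Code.eval, ha, hb]; rfl⟩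
  | prec f g hf hg =>
    obtain ⟨a, ha⟩ := hf
    obtain ⟨b, hb⟩ := hg
    exact ⟨.prec a b, by simp only [OCode.eval, Nat.Partrec.Code.eval, ha, hb]; rfl⟩
  | rfind' f hf =>
    obtain ⟨a, ha⟩ := hf
    exact ⟨.rfind' a, by simp only [OCode.eval, Nat.Partrec.Code.eval, ha]; rfl⟩

theorem OCode.exists_code_eval_eq_eval_zeroO (c : OCode) :
    ∃ c' : Nat.Partrec.Code, c'.eval = c.eval zeroO := by
  induction c with
  | zero => exact ⟨.zero, rfl⟩
  | succ => exact ⟨.succ, rfl⟩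
  | left => exact ⟨.left, rfl⟩
  | right => exact ⟨.right, rfl⟩
  | oracle => exact ⟨.zero, rfl⟩
  | pair f g hf hg =>
    obtain ⟨a, ha⟩ := hf
    obtain ⟨b, hb⟩ := hg
    exact ⟨.pair a b, by simp only [OCode.eval, Nat.Partrec.Code.eval, ha, hb]; rfl⟩
  | comp f g hf hg =>
    obtain ⟨a, ha⟩ := hf
    obtain ⟨b, hb⟩ := hg
    exact ⟨.comp a b, by simp only [OCode.eval, Nat.Partrec.Code.eval, ha, hb]; rfl⟩
  | prec f g hf hg =>
    obtain ⟨a, ha⟩ := hf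
    obtain ⟨b, hb⟩ := hg
    exact ⟨.prec a b, by simp only [OCode.eval, Nat.Partrec.Code.eval, ha, hb]; rfl⟩
  | rfind' f hf =>
    obtain ⟨a, ha⟩ := hf
    exact ⟨.rfind' a, by simp only [OCode.eval, Nat.Partrec.Code.eval, ha]; rfl⟩

theorem RecursiveIn.of_partrec {f : ℕ →. ℕ} (hf : Nat.Partrec f) : RecursiveIn O f := by
  obtain ⟨c, rfl⟩ := Nat.Partrec.Code.exists_code.1 hf
  exact OCode.exists_eval_eq_code_eval O c

theorem ComputableIn.of_computable {f : ℕ → ℕ} (hf : Computable f) : ComputableIn O f :=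
  .of_partrec (Partrec.nat_iff.1 hf)

theorem ComputableIn.computable {f : ℕ → ℕ} (hf : ComputableIn zeroO f) : Computable f := by
  obtain ⟨c, hc⟩ := hf
  obtain ⟨c', hc'⟩ := c.exists_code_eval_eq_eval_zeroO
  exact Partrec.nat_iff.2 (Nat.Partrec.Code.exists_code.2 ⟨c', hc'.trans hc⟩)

theorem RecursiveIn.comp {f g : ℕ →. ℕ} (hf : RecursiveIn O f) (hg : RecursiveIn O g) :
    RecursiveIn O fun n => g n >>= f := by
  obtain ⟨a, rfl⟩ := hf
  obtain ⟨b, rfl⟩ := hg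
  exact ⟨.comp a b, rfl⟩

theorem RecursiveIn.pair {f g : ℕ →. ℕ} (hf : RecursiveIn O f) (hg : RecursiveIn O g) :
    RecursiveIn O fun n => Nat.pair <$> f n <*> g n := by
  obtain ⟨a, rfl⟩ := hf
  obtain ⟨b, rfl⟩ := hg
  exact ⟨.pair a b, rfl⟩

theorem RecursiveIn.comp_total {f : ℕ →. ℕ} {g : ℕ → ℕ} (hf : RecursiveIn O f)
    (hg : ComputableIn O g) : RecursiveIn O fun n => f (g n) := by
  have e : (fun n => Part.some (g n) >>= f) = fun n => f (g n) :=
    funext fun n => Part.bind_some _ _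
  exact e ▸ hf.comp hg

theorem ComputableIn.comp {f g : ℕ → ℕ} (hf : ComputableIn O f) (hg : ComputableIn O g) :
    ComputableIn O fun n => f (g n) :=
  RecursiveIn.comp_total (f := fun n => Part.some (f n)) hf hg

theorem ComputableIn.pair {f g : ℕ → ℕ} (hf : ComputableIn O f) (hg : ComputableIn O g) :
    ComputableIn O fun n => Nat.pair (f n) (g n) := by
  simpa [ComputableIn, Seq.seq] using RecursiveIn.pair hf hg

theorem ComputableIn.oracle : ComputableIn O fun n => (O n).toNat :=
  ⟨.oracle, rfl⟩

theorem ComputableIn.id : ComputableIn O fun n => n :=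
  .of_computable Computable.id

theorem ComputableIn.const (k : ℕ) : ComputableIn O fun _ => k :=
  .of_computable (Computable.const k)

theorem ComputableIn.left : ComputableIn O fun n => n.unpair.1 :=
  ⟨.left, rfl⟩

theorem ComputableIn.right : ComputableIn O fun n => n.unpair.2 :=
  ⟨.right, rfl⟩

/-- Curried two-argument version of `ComputableIn`. -/
def ComputableIn₂ (O : ℕ → Bool) (f : ℕ → ℕ → ℕ) : Prop :=
  ComputableIn O fun n => f n.unpair.1 n.unpair.2

theorem ComputableIn₂.comp {f : ℕ → ℕ → ℕ} {g h : ℕ → ℕ} (hf : ComputableIn₂ O f)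
    (hg : ComputableIn O g) (hh : ComputableIn O h) : ComputableIn O fun n => f (g n) (h n) := by
  simpa using ComputableIn.comp hf (hg.pair hh)

theorem ComputableIn₂.of_computable {f : ℕ → ℕ → ℕ} (hf : Computable₂ f) : ComputableIn₂ O f :=
  ComputableIn.of_computable
    (hf.comp (Computable.fst.comp Computable.unpair) (Computable.snd.comp Computable.unpair))

theorem ComputableIn.natRec {a b : ℕ → ℕ} {h : ℕ → ℕ → ℕ → ℕ} (ha : ComputableIn O a)
    (hb : ComputableIn O b)
    (hh : ComputableIn O fun m => h m.unpair.1 m.unpair.2.unpair.1 m.unpair.2.unpair.2) :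
    ComputableIn O fun n => Nat.rec (motive := fun _ => ℕ) (a n) (fun y IH => h n y IH) (b n) := by
  have key : ComputableIn O fun n => Nat.rec (motive := fun _ => ℕ) (a n.unpair.1)
      (fun y IH => h n.unpair.1 y IH) n.unpair.2 := by
    obtain ⟨ca, hca⟩ := ha
    obtain ⟨ch, hch⟩ := hh
    refine ⟨.prec ca ch, ?_⟩
    funext n
    simp only [OCode.eval, Nat.unpaired, hca, hch]
    induction n.unpair.2 with
    | zero => rfl
    | succ k ih =>
      simp only [ih]
      exact (Part.bind_some _ _).trans (by simp)
  simpa using key.comp (ComputableIn.id.pair hb)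

theorem ComputableIn.natCases {a b : ℕ → ℕ} {h : ℕ → ℕ → ℕ} (ha : ComputableIn O a)
    (hb : ComputableIn O b) (hh : ComputableIn₂ O h) :
    ComputableIn O fun n => Nat.casesOn (motive := fun _ => ℕ) (b n) (a n) (fun y => h n y) := by
  have := ComputableIn.natRec (h := fun n y _ => h n y) ha hb
    (hh.comp .left (ComputableIn.left.comp .right))
  convert this using 2 with n

theorem RecursiveIn.rfind {p : ℕ → ℕ → ℕ} (hp : ComputableIn₂ O p) :
    RecursiveIn O fun a => Nat.rfind fun n => Part.some (decide (p a n = 0)) := by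
  obtain ⟨c, hc⟩ := hp
  have : RecursiveIn O ((OCode.rfind' c).eval O) := ⟨_, rfl⟩
  convert this.comp_total (ComputableIn.id.pair (.const 0)) using 2 with a
  simp only [OCode.eval, Nat.unpaired, hc]
  simp [Part.map_id']

end CLPaper

namespace CLPaper

variable {O : ℕ → Bool}

/-- `g` is a computable stage-by-stage enumeration of the graph of `f`: `g x s = y + 1` means that
the value `f x = y` has been found by stage `s`, and `g x s = 0` that no value is known yet. -/
structure IsStaging (O : ℕ → Bool) (f : ℕ →. ℕ) (g : ℕ → ℕ → ℕ) : Prop where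
  computable : ComputableIn₂ O g
  mono : ∀ {x y s t}, s ≤ t → g x s = y + 1 → g x t = y + 1
  mem_iff : ∀ {x y}, y ∈ f x ↔ ∃ s, g x s = y + 1

theorem IsStaging.of_total {f : ℕ → ℕ} (hf : ComputableIn O f) :
    IsStaging O (fun n => Part.some (f n)) fun x _ => f x + 1 where
  computable := (ComputableIn.of_computable Computable.succ).comp (hf.comp .left)
  mono _ h := h
  mem_iff := by simp [eq_comm]

theorem IsStaging.pair {f₁ f₂ : ℕ →. ℕ} {g₁ g₂ : ℕ → ℕ → ℕ} (h₁ : IsStaging O f₁ g₁)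
    (h₂ : IsStaging O f₂ g₂) :
    ∃ g, IsStaging O (fun n => Nat.pair <$> f₁ n <*> f₂ n) g := by
  have key : ∀ x s y, Nat.casesOn (motive := fun _ => ℕ) (g₁ x s) 0
      (fun a => Nat.casesOn (motive := fun _ => ℕ) (g₂ x s) 0 fun b => Nat.pair a b + 1) = y + 1 ↔
      ∃ a b, g₁ x s = a + 1 ∧ g₂ x s = b + 1 ∧ Nat.pair a b = y := by
    intro x s y
    cases g₁ x s <;> cases g₂ x s <;> simp
  refine ⟨fun x s => Nat.casesOn (motive := fun _ => ℕ) (g₁ x s) 0 fun a =>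
    Nat.casesOn (motive := fun _ => ℕ) (g₂ x s) 0 fun b => Nat.pair a b + 1, ?_, ?_, ?_⟩
  · refine .natCases (.const 0) h₁.computable (.natCases (h := fun n b => Nat.pair n.unpair.2 b + 1)
      (.const 0) (h₂.computable.comp (.comp .left .left) (.comp .right .left)) ?_)
    exact (ComputableIn.of_computable Computable.succ).comp
      ((ComputableIn.right.comp .left).pair .right)
  · intro x y s t hst
    simp only [key]
    rintro ⟨a, b, ha, hb, rfl⟩
    exact ⟨a, b, h₁.mono hst ha, h₂.mono hst hb, rfl⟩
  · intro x y
    simp only [key]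
    constructor
    · intro hy
      obtain ⟨a, ha, b, hb, rfl⟩ : ∃ a ∈ f₁ x, ∃ b ∈ f₂ x, Nat.pair a b = y := by
        simpa [Seq.seq] using hy
      obtain ⟨s, hs⟩ := h₁.mem_iff.1 ha
      obtain ⟨t, ht⟩ := h₂.mem_iff.1 hb
      exact ⟨max s t, a, b, h₁.mono (le_max_left _ _) hs, h₂.mono (le_max_right _ _) ht, rfl⟩
    · rintro ⟨s, a, b, ha, hb, rfl⟩
      have : ∃ a' ∈ f₁ x, ∃ b' ∈ f₂ x, Nat.pair a' b' = Nat.pair a b :=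
        ⟨a, h₁.mem_iff.2 ⟨s, ha⟩, b, h₂.mem_iff.2 ⟨s, hb⟩, rfl⟩
      simpa [Seq.seq] using this

theorem IsStaging.comp {f₁ f₂ : ℕ →. ℕ} {g₁ g₂ : ℕ → ℕ → ℕ} (h₁ : IsStaging O f₁ g₁)
    (h₂ : IsStaging O f₂ g₂) :
    ∃ g, IsStaging O (fun n => f₂ n >>= f₁) g := by
  have key : ∀ x s y, Nat.casesOn (motive := fun _ => ℕ) (g₂ x s) 0 (fun a => g₁ a s) = y + 1 ↔
      ∃ a, g₂ x s = a + 1 ∧ g₁ a s = y + 1 := by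
    intro x s y
    cases g₂ x s <;> simp
  refine ⟨fun x s => Nat.casesOn (motive := fun _ => ℕ) (g₂ x s) 0 fun a => g₁ a s, ?_, ?_, ?_⟩
  · exact .natCases (h := fun n a => g₁ a n.unpair.2) (.const 0) h₂.computable
      (h₁.computable.comp .right (.comp .right .left))
  · intro x y s t hst
    simp only [key]
    rintro ⟨a, ha, hb⟩
    exact ⟨a, h₂.mono hst ha, h₁.mono hst hb⟩
  · intro x y
    simp only [key]
    constructor
    · intro hy
      obtain ⟨a, ha, hb⟩ := Part.mem_bind_iff.1 hy
      obtain ⟨s, hs⟩ := h₂.mem_iff.1 ha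
      obtain ⟨t, ht⟩ := h₁.mem_iff.1 hb
      exact ⟨max s t, a, h₂.mono (le_max_left _ _) hs, h₁.mono (le_max_right _ _) ht⟩
    · rintro ⟨s, a, ha, hb⟩
      exact Part.mem_bind_iff.2 ⟨a, h₂.mem_iff.2 ⟨s, ha⟩, h₁.mem_iff.2 ⟨s, hb⟩⟩

theorem IsStaging.prec {f₁ f₂ : ℕ →. ℕ} {g₁ g₂ : ℕ → ℕ → ℕ} (h₁ : IsStaging O f₁ g₁)
    (h₂ : IsStaging O f₂ g₂) :
    ∃ g, IsStaging O (Nat.unpaired fun a n => n.rec (f₁ a) fun y IH => do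
      let i ← IH
      f₂ (Nat.pair a (Nat.pair y i))) g := by
  let R (a s n : ℕ) : ℕ := Nat.rec (motive := fun _ => ℕ) (g₁ a s) (fun y IH =>
    Nat.casesOn (motive := fun _ => ℕ) IH 0 fun v => g₂ (Nat.pair a (Nat.pair y v)) s) n
  have key : ∀ a s n y, R a s (n + 1) = y + 1 ↔
      ∃ v, R a s n = v + 1 ∧ g₂ (Nat.pair a (Nat.pair n v)) s = y + 1 := by
    intro a s n y
    change Nat.casesOn (motive := fun _ => ℕ) (R a s n) 0
      (fun v => g₂ (Nat.pair a (Nat.pair n v)) s) = y + 1 ↔ _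
    cases R a s n <;> simp
  have mono : ∀ a n y s t, s ≤ t → R a s n = y + 1 → R a t n = y + 1 := by
    intro a n
    induction n with
    | zero => exact fun y s t hst h => h₁.mono hst h
    | succ n ih =>
      intro y s t hst
      simp only [key]
      rintro ⟨v, hv, h⟩
      exact ⟨v, ih _ _ _ hst hv, h₂.mono hst h⟩
  refine ⟨fun x s => R x.unpair.1 s x.unpair.2, ?_, ?_, ?_⟩
  · refine .natRec (a := fun m => g₁ m.unpair.1.unpair.1 m.unpair.2)
      (h := fun m y IH => Nat.casesOn (motive := fun _ => ℕ) IH 0 fun v =>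
        g₂ (Nat.pair m.unpair.1.unpair.1 (Nat.pair y v)) m.unpair.2)
      (h₁.computable.comp (.comp .left .left) .right) (.comp .right .left) ?_
    refine .natCases (h := fun m v => g₂ (Nat.pair m.unpair.1.unpair.1.unpair.1
      (Nat.pair m.unpair.2.unpair.1 v)) m.unpair.1.unpair.2) (.const 0) (.comp .right .right) ?_
    have l : ComputableIn O fun n => n.unpair.1.unpair.1 := .comp .left .left
    exact h₂.computable.comp ((ComputableIn.left.comp (.comp .left l)).pair
      ((ComputableIn.left.comp (.comp .right .left)).pair .right)) (.comp .right l)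
  · exact fun hst h => mono _ _ _ _ _ hst h
  · intro x y
    simp only [Nat.unpaired]
    generalize x.unpair.1 = a, x.unpair.2 = n
    induction n generalizing y with
    | zero => exact h₁.mem_iff
    | succ n ih =>
      simp only [key]
      refine Part.mem_bind_iff.trans ⟨?_, ?_⟩
      · rintro ⟨v, hv, h⟩
        obtain ⟨s, hs⟩ := ih.1 hv
        obtain ⟨t, ht⟩ := h₂.mem_iff.1 h
        exact ⟨max s t, v, mono _ _ _ _ _ (le_max_left _ _) hs, h₂.mono (le_max_right _ _) ht⟩
      · rintro ⟨s, v, hv, h⟩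
        exact ⟨v, ih.2 ⟨s, hv⟩, h₂.mem_iff.2 ⟨s, h⟩⟩

theorem IsStaging.rfind' {f₁ : ℕ →. ℕ} {g₁ : ℕ → ℕ → ℕ} (h₁ : IsStaging O f₁ g₁) :
    ∃ g, IsStaging O (Nat.unpaired fun a m => (Nat.rfind fun n => (fun x => x = 0) <$>
      f₁ (Nat.pair a (n + m))).map (· + m)) g := by
  -- `R` is `0` while searching, `1` if the search is stuck and `k + 2` if the answer is `k`.
  let R (a m s j : ℕ) : ℕ := Nat.rec (motive := fun _ => ℕ) 0 (fun i IH =>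
    Nat.casesOn (motive := fun _ => ℕ) IH
      (Nat.casesOn (motive := fun _ => ℕ) (g₁ (Nat.pair a (i + m)) s) 1 fun v =>
        Nat.casesOn (motive := fun _ => ℕ) v (i + m + 2) fun _ => 0)
      fun r => r + 1) j
  have R_succ : ∀ a m s j, R a m s (j + 1) = Nat.casesOn (motive := fun _ => ℕ) (R a m s j)
      (Nat.casesOn (motive := fun _ => ℕ) (g₁ (Nat.pair a (j + m)) s) 1 fun v =>
        Nat.casesOn (motive := fun _ => ℕ) v (j + m + 2) fun _ => 0)
      fun r => r + 1 := fun _ _ _ _ => rfl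
  have R_zero : ∀ a m s j, R a m s j = 0 ↔
      ∀ i < j, ∃ v, g₁ (Nat.pair a (i + m)) s = v + 2 := by
    intro a m s j
    induction j with
    | zero => simp [R]
    | succ j ih =>
      rw [R_succ, Nat.forall_lt_succ_right, ← ih]
      rcases R a m s j with _ | r
      · rcases g₁ (Nat.pair a (j + m)) s with _ | _ | v <;> simp
      · simp
  have key : ∀ a m s j y, R a m s j = y + 2 ↔ ∃ k < j, k + m = y ∧
      g₁ (Nat.pair a (k + m)) s = 1 ∧ ∀ i < k, ∃ v, g₁ (Nat.pair a (i + m)) s = v + 2 := by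
    intro a m s j y
    induction j with
    | zero => simp [R]
    | succ j ih =>
      have : (∃ k < j + 1, k + m = y ∧ g₁ (Nat.pair a (k + m)) s = 1 ∧
          ∀ i < k, ∃ v, g₁ (Nat.pair a (i + m)) s = v + 2) ↔ R a m s j = y + 2 ∨
          (j + m = y ∧ g₁ (Nat.pair a (j + m)) s = 1 ∧ R a m s j = 0) := by
        rw [ih, R_zero]
        constructor
        · rintro ⟨k, hk, h⟩
          rcases Nat.lt_succ_iff_lt_or_eq.1 hk with hk | rfl
          · exact .inl ⟨k, hk, h⟩
          · exact .inr h
        · rintro (⟨k, hk, h⟩ | h)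
          · exact ⟨k, by omega, h⟩
          · exact ⟨j, by omega, h⟩
      rw [this, R_succ]
      rcases R a m s j with _ | r
      · rcases g₁ (Nat.pair a (j + m)) s with _ | _ | v <;> simp
      · simp
  have pred_iff : ∀ n y, Nat.pred n = y + 1 ↔ n = y + 2 := by
    intro n y
    cases n <;> simp
  refine ⟨fun x s => Nat.pred (R x.unpair.1 x.unpair.2 s s), ?_, ?_, ?_⟩
  · refine ComputableIn.comp (.of_computable Primrec.pred.to_comp) (.natRec (h := fun x i IH =>
      Nat.casesOn (motive := fun _ => ℕ) IH
      (Nat.casesOn (motive := fun _ => ℕ)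
        (g₁ (Nat.pair x.unpair.1.unpair.1 (i + x.unpair.1.unpair.2)) x.unpair.2) 1 fun v =>
        Nat.casesOn (motive := fun _ => ℕ) v (i + x.unpair.1.unpair.2 + 2) fun _ => 0)
      fun r => r + 1) (.const 0) .right ?_)
    have l : ComputableIn O fun n => n.unpair.1.unpair.1 := .comp .left .left
    have hadd : ∀ {a b : ℕ → ℕ}, ComputableIn O a → ComputableIn O b →
        ComputableIn O fun n => a n + b n := fun ha hb =>
      (ComputableIn₂.of_computable (f := (· + ·)) Primrec.nat_add.to_comp).comp ha hb
    have im : ComputableIn O fun n => n.unpair.2.unpair.1 + n.unpair.1.unpair.1.unpair.2 :=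
      hadd (.comp .left .right) (.comp .right l)
    refine .natCases (h := fun _ r => r + 1) (.natCases (h := fun n v =>
        Nat.casesOn (motive := fun _ => ℕ) v
          (n.unpair.2.unpair.1 + n.unpair.1.unpair.1.unpair.2 + 2) fun _ => 0)
      (.const 1) ?_ ?_) (.comp .right .right) (hadd .right (.const 1))
    · exact h₁.computable.comp (.pair (.comp .left l) im) (.comp .right .left)
    · exact .natCases (h := fun _ _ => 0) (hadd (im.comp .left) (.const 2)) .right (.const 0)
  · intro x y s t hst
    simp only [pred_iff, key]
    rintro ⟨k, hk, hy, h0, h⟩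
    refine ⟨k, hk.trans_le hst, hy, h₁.mono hst h0, fun i hi => ?_⟩
    obtain ⟨v, hv⟩ := h i hi
    exact ⟨v, h₁.mono hst hv⟩
  · intro x y
    simp only [pred_iff, key, Nat.unpaired]
    generalize x.unpair.1 = a, x.unpair.2 = m
    simp only [Part.mem_map_iff]
    constructor
    · rintro ⟨k, hk, rfl⟩
      obtain ⟨h0, h⟩ := Nat.mem_rfind.1 hk
      have h0' : 0 ∈ f₁ (Nat.pair a (k + m)) := by simpa using h0
      obtain ⟨s, hs⟩ := h₁.mem_iff.1 h0'
      have : ∀ i, ∃ t, i < k → ∃ v, g₁ (Nat.pair a (i + m)) t = v + 2 := by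
        intro i
        by_cases hi : i < k
        · obtain ⟨v, hv, hv0⟩ : ∃ v, v ∈ f₁ (Nat.pair a (i + m)) ∧ ¬ v = 0 := by
            simpa using h hi
          obtain ⟨t, ht⟩ := h₁.mem_iff.1 hv
          exact ⟨t, fun _ => ⟨v - 1, by omega⟩⟩
        · exact ⟨0, fun h => absurd h hi⟩
      choose t ht using this
      refine ⟨max (max s (k + 1)) ((Finset.range k).sup t), k, by omega, rfl,
        h₁.mono (by omega) hs, fun i hi => ?_⟩
      obtain ⟨v, hv⟩ := ht i hi
      exact ⟨v, h₁.mono ((Finset.le_sup (Finset.mem_range.2 hi)).trans (le_max_right _ _)) hv⟩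
    · rintro ⟨s, k, -, rfl, h0, h⟩
      refine ⟨k, Nat.mem_rfind.2 ⟨?_, fun {i} hi => ?_⟩, rfl⟩
      · have : 0 ∈ f₁ (Nat.pair a (k + m)) := h₁.mem_iff.2 ⟨s, h0⟩
        simpa using this
      · obtain ⟨v, hv⟩ := h i hi
        have : ∃ v, v ∈ f₁ (Nat.pair a (i + m)) ∧ ¬ v = 0 :=
          ⟨v + 1, h₁.mem_iff.2 ⟨s, hv⟩, by omega⟩
        simpa using this

theorem RecursiveIn.exists_isStaging {f : ℕ →. ℕ} (hf : RecursiveIn O f) :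
    ∃ g, IsStaging O f g := by
  obtain ⟨c, rfl⟩ := hf
  induction c with
  | zero => exact ⟨_, .of_total (.const 0)⟩
  | succ => exact ⟨_, .of_total (.of_computable Computable.succ)⟩
  | left => exact ⟨_, .of_total .left⟩
  | right => exact ⟨_, .of_total .right⟩
  | oracle => exact ⟨_, .of_total .oracle⟩
  | pair _ _ h₁ h₂ => exact h₁.choose_spec.pair h₂.choose_spec
  | comp _ _ h₁ h₂ => exact h₁.choose_spec.comp h₂.choose_spec
  | prec _ _ h₁ h₂ => exact h₁.choose_spec.prec h₂.choose_spec
  | rfind' _ h => exact h.choose_spec.rfind'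

end CLPaper

namespace CLPaper

/-- Concatenates a list of optional lists, failing if one of them is missing. -/
def collect (l : List (Option (List ℕ))) : Option (List ℕ) :=
  l.foldr (fun x acc => x.bind fun a => acc.map fun b => a ++ b) (some [])

/-- One step in the simultaneous course-of-values computation of the free variables of the term and
of the formula with code `k`, where `none` stands for ill-formed codes.  Here `arF` and `arP` are the
arities of the head symbol and `tab` lists the results for smaller codes. -/
def varsStep (arF arP : Option ℕ) (k : ℕ) (tab : List (Option (List ℕ) × Option (List ℕ))) :
    Option (List ℕ) × Option (List ℕ) :=
  let t := k.unpair.1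
  let r := k.unpair.2
  let a := r.unpair.1
  let b := r.unpair.2
  let args := Denumerable.ofNat (List ℕ) b
  let T : ℕ → Option (List ℕ) := fun i => (tab.getD i default).1
  let F : ℕ → Option (List ℕ) := fun i => (tab.getD i default).2
  (if t = 0 then some [r]
    else if t = 1 then (if arF = some args.length then collect (args.map T) else none)
    else none,
   if t = 0 then (if arP = some args.length then collect (args.map T) else none)
    else if t = 1 then collect [T a, T b]
    else if t = 2 then (if r = 0 then some [] else none)
    else if t = 3 then (if r = 0 then some [] else none)
    else if t = 4 then F r
    else if t = 5 then collect [F a, F b]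
    else if t = 6 then (F b).map fun l => l.flatMap fun n => if n = a then [] else [n]
    else if t = 7 then (F b).map fun l => l.flatMap fun n => if n = a then [] else [n]
    else none)

theorem primrec_collect : Primrec collect := by
  refine Primrec.list_foldr (h := fun _ (p : Option (List ℕ) × Option (List ℕ)) => p.1.bind fun a => p.2.map fun b => a ++ b)
    Primrec.id (Primrec.const _) ?_
  refine Primrec.option_bind (Primrec.fst.comp Primrec.snd) ?_
  refine Primrec.option_map (Primrec.snd.comp (Primrec.snd.comp Primrec.fst)) ?_
  exact Primrec.list_append.comp (Primrec.snd.comp Primrec.fst) Primrec.snd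

theorem primrec_varsStep : Primrec fun p : (Option ℕ × Option ℕ) × ℕ ×
    List (Option (List ℕ) × Option (List ℕ)) => varsStep p.1.1 p.1.2 p.2.1 p.2.2 := by
  let α := (Option ℕ × Option ℕ) × ℕ × List (Option (List ℕ) × Option (List ℕ))
  have k : Primrec fun p : α => p.2.1 := Primrec.fst.comp Primrec.snd
  have t : Primrec fun p : α => p.2.1.unpair.1 := Primrec.fst.comp (Primrec.unpair.comp k)
  have r : Primrec fun p : α => p.2.1.unpair.2 := Primrec.snd.comp (Primrec.unpair.comp k)
  have a : Primrec fun p : α => p.2.1.unpair.2.unpair.1 := Primrec.fst.comp (Primrec.unpair.comp r)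
  have b : Primrec fun p : α => p.2.1.unpair.2.unpair.2 := Primrec.snd.comp (Primrec.unpair.comp r)
  have args : Primrec fun p : α => Denumerable.ofNat (List ℕ) p.2.1.unpair.2.unpair.2 :=
    (Primrec.ofNat (List ℕ)).comp b
  have get : Primrec₂ fun (p : α) (i : ℕ) => p.2.2.getD i default :=
    (Primrec.list_getD _).comp (Primrec.snd.comp (Primrec.snd.comp Primrec.fst)) Primrec.snd
  have T : Primrec₂ fun (p : α) (i : ℕ) => (p.2.2.getD i default).1 := Primrec.fst.comp get
  have F : Primrec₂ fun (p : α) (i : ℕ) => (p.2.2.getD i default).2 := Primrec.snd.comp get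
  have tag : ∀ i, PrimrecPred fun p : α => p.2.1.unpair.1 = i := fun i =>
    Primrec.eq.comp t (Primrec.const i)
  have two : ∀ {x y : α → Option (List ℕ)}, Primrec x → Primrec y →
      Primrec fun p => collect [x p, y p] := fun hx hy =>
    primrec_collect.comp (Primrec.list_cons.comp hx (Primrec.list_cons.comp hy (Primrec.const [])))
  have many := primrec_collect.comp (Primrec.list_map args T)
  have len := Primrec.option_some.comp (Primrec.list_length.comp args)
  have arF : Primrec fun p : α => p.1.1 := Primrec.fst.comp Primrec.fst
  have arP : Primrec fun p : α => p.1.2 := Primrec.snd.comp Primrec.fst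
  have unit : Primrec fun p : α => if p.2.1.unpair.2 = 0 then some ([] : List ℕ) else none :=
    Primrec.ite (Primrec.eq.comp r (Primrec.const 0)) (Primrec.const _) (Primrec.const _)
  have bind : Primrec fun p : α => ((p.2.2.getD p.2.1.unpair.2.unpair.2 default).2).map fun l =>
      l.flatMap fun n => if n = p.2.1.unpair.2.unpair.1 then [] else [n] := by
    refine Primrec.option_map (F.comp Primrec.id b) (Primrec.list_flatMap Primrec.snd ?_)
    exact Primrec.ite (Primrec.eq.comp Primrec.snd (a.comp (Primrec.fst.comp Primrec.fst)))
      (Primrec.const _) (Primrec.list_cons.comp Primrec.snd (Primrec.const []))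
  refine Primrec.pair ?_ ?_
  · refine Primrec.ite (tag 0) (Primrec.option_some.comp (Primrec.list_cons.comp r
      (Primrec.const []))) (Primrec.ite (tag 1) ?_ (Primrec.const _))
    exact Primrec.ite (Primrec.eq.comp arF len) many (Primrec.const _)
  · refine Primrec.ite (tag 0) (Primrec.ite (Primrec.eq.comp arP len) many (Primrec.const _)) ?_
    refine Primrec.ite (tag 1) (two (T.comp Primrec.id a) (T.comp Primrec.id b)) ?_
    refine Primrec.ite (tag 2) unit (Primrec.ite (tag 3) unit ?_)
    refine Primrec.ite (tag 4) (F.comp Primrec.id r) ?_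
    refine Primrec.ite (tag 5) (two (F.comp Primrec.id a) (F.comp Primrec.id b)) ?_
    exact Primrec.ite (tag 6) bind (Primrec.ite (tag 7) bind (Primrec.const _))

/-- The results of `varsStep` for all codes below `n`. -/
def varsTable (L : CLang) (n : ℕ) : List (Option (List ℕ) × Option (List ℕ)) :=
  Nat.rec [] (fun k tab => tab ++ [varsStep (L.funcArity k.unpair.2.unpair.1)
    (L.predArity k.unpair.2.unpair.1) k tab]) n

/-- The free variables of the term, resp. of the formula, with a given code. -/
def codeVars (L : CLang) (k : ℕ) : Option (List ℕ) × Option (List ℕ) :=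
  varsStep (L.funcArity k.unpair.2.unpair.1) (L.predArity k.unpair.2.unpair.1) k (varsTable L k)

theorem CLang.IsComputable.computable_varsStep {L : CLang} (hL : L.IsComputable) :
    Computable fun p : ℕ × List (Option (List ℕ) × Option (List ℕ)) =>
      varsStep (L.funcArity p.1.unpair.2.unpair.1) (L.predArity p.1.unpair.2.unpair.1) p.1 p.2 := by
  have hF : Computable L.funcArity := Computable.encode_iff.1 hL.1.computable
  have hP : Computable L.predArity := Computable.encode_iff.1 hL.2.computable
  have s : Computable fun p : ℕ × List (Option (List ℕ) × Option (List ℕ)) =>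
      p.1.unpair.2.unpair.1 :=
    Computable.fst.comp (Computable.unpair.comp (Computable.snd.comp (Computable.unpair.comp
      Computable.fst)))
  have := ((hF.comp s).pair (hP.comp s)).pair
    (Computable.id (α := ℕ × List (Option (List ℕ) × Option (List ℕ))))
  exact (primrec_varsStep.to_comp.comp this).of_eq fun p => by simp only [id]

theorem CLang.IsComputable.computable_varsTable {L : CLang} (hL : L.IsComputable) :
    Computable (varsTable L) := by
  have h := hL.computable_varsStep.comp
    (Computable.snd (α := ℕ) (β := ℕ × List (Option (List ℕ) × Option (List ℕ))))
  have h' : Computable₂ fun (_ : ℕ) (p : ℕ × List (Option (List ℕ) × Option (List ℕ))) =>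
      p.2 ++ [varsStep (L.funcArity p.1.unpair.2.unpair.1) (L.predArity p.1.unpair.2.unpair.1)
        p.1 p.2] :=
    Computable.list_concat.comp (Computable.snd.comp Computable.snd) h
  exact Computable.nat_rec Computable.id (Computable.const []) h'

theorem CLang.IsComputable.computable_codeVars {L : CLang} (hL : L.IsComputable) :
    Computable (codeVars L) :=
  (hL.computable_varsStep.comp (Computable.id.pair hL.computable_varsTable)).of_eq fun _ => rfl

theorem length_varsTable (L : CLang) (n : ℕ) : (varsTable L n).length = n := by
  induction n with
  | zero => rfl
  | succ n ih =>
    change (varsTable L n ++ [codeVars L n]).length = n + 1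
    simp [ih]

theorem varsTable_getD (L : CLang) {i n : ℕ} (h : i < n) (d) :
    (varsTable L n).getD i d = codeVars L i := by
  induction n with
  | zero => omega
  | succ n ih =>
    change (varsTable L n ++ [codeVars L n]).getD i d = _
    have hl := length_varsTable L n
    rcases Nat.lt_succ_iff_lt_or_eq.1 h with h | rfl
    · rw [List.getD_append _ _ _ _ (by omega), ih h]
    · rw [List.getD_append_right _ _ _ _ (by omega)]
      simp [hl]

theorem lt_of_mem_ofNat_list {i n : ℕ} (h : i ∈ Denumerable.ofNat (List ℕ) n) : i < n := by
  induction n using Nat.strong_induction_on with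
  | _ n ih =>
    rcases n with _ | n
    · simp at h
    · rw [Denumerable.list_ofNat_succ, List.mem_cons] at h
      rcases h with rfl | h
      · exact Nat.lt_succ_of_le (Nat.unpair_left_le n)
      · have := ih _ (Nat.lt_succ_of_le (Nat.unpair_right_le n)) h
        have := Nat.unpair_right_le n
        omega

section codeVars

variable (L : CLang)

theorem codeVars_fst_var (n : ℕ) : (codeVars L (Nat.pair 0 n)).1 = some [n] := by
  simp [codeVars, varsStep]

theorem map_varsTable {n : ℕ} {l : List ℕ} (h : ∀ i ∈ l, i < n) :
    (l.map fun i => ((varsTable L n).getD i default).1) = l.map fun i => (codeVars L i).1 :=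
  List.map_congr_left fun i hi => by rw [varsTable_getD L (h i hi)]

theorem codeVars_fst_func (f : ℕ) (l : List ℕ) :
    (codeVars L (Nat.pair 1 (Nat.pair f (Encodable.encode l)))).1 =
      if L.funcArity f = some l.length then collect (l.map fun i => (codeVars L i).1)
      else none := by
  have h : ∀ i ∈ l, i < Nat.pair 1 (Nat.pair f (Encodable.encode l)) := fun i hi => by
    have := lt_of_mem_ofNat_list (n := Encodable.encode l) (i := i) (by simpa using hi)
    have := Nat.right_le_pair f (Encodable.encode l)
    have := Nat.right_le_pair 1 (Nat.pair f (Encodable.encode l))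
    omega
  rw [← map_varsTable L h]
  simp [codeVars, varsStep]

theorem codeVars_fst_of_two_le {t : ℕ} (ht : 2 ≤ t) (r : ℕ) :
    (codeVars L (Nat.pair t r)).1 = none := by
  simp [codeVars, varsStep, show t ≠ 0 by omega, show t ≠ 1 by omega]

theorem codeVars_snd_pred (P : ℕ) (l : List ℕ) :
    (codeVars L (Nat.pair 0 (Nat.pair P (Encodable.encode l)))).2 =
      if L.predArity P = some l.length then collect (l.map fun i => (codeVars L i).1)
      else none := by
  have h : ∀ i ∈ l, i < Nat.pair 0 (Nat.pair P (Encodable.encode l)) := fun i hi => by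
    have := lt_of_mem_ofNat_list (n := Encodable.encode l) (i := i) (by simpa using hi)
    have := Nat.right_le_pair P (Encodable.encode l)
    have := Nat.right_le_pair 0 (Nat.pair P (Encodable.encode l))
    omega
  rw [← map_varsTable L h]
  simp [codeVars, varsStep]

theorem varsTable_pair_getD {t r i : ℕ} (ht : 0 < t) (hi : i ≤ r) (d) :
    (varsTable L (Nat.pair t r)).getD i d = codeVars L i :=
  varsTable_getD L (by have := Nat.add_le_pair t r; omega) d

theorem codeVars_snd_dmetric (a b : ℕ) :
    (codeVars L (Nat.pair 1 (Nat.pair a b))).2 =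
      collect [(codeVars L a).1, (codeVars L b).1] := by
  rw [← varsTable_pair_getD L one_pos (Nat.left_le_pair a b) default,
    ← varsTable_pair_getD L one_pos (Nat.right_le_pair a b) default]
  simp [codeVars, varsStep]

theorem codeVars_snd_zero (r : ℕ) :
    (codeVars L (Nat.pair 2 r)).2 = if r = 0 then some [] else none := by
  simp [codeVars, varsStep]

theorem codeVars_snd_one (r : ℕ) :
    (codeVars L (Nat.pair 3 r)).2 = if r = 0 then some [] else none := by
  simp [codeVars, varsStep]

theorem codeVars_snd_half (r : ℕ) : (codeVars L (Nat.pair 4 r)).2 = (codeVars L r).2 := by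
  rw [← varsTable_pair_getD L (show 0 < 4 by decide) (le_refl r) default]
  simp [codeVars, varsStep]

theorem codeVars_snd_dotminus (a b : ℕ) :
    (codeVars L (Nat.pair 5 (Nat.pair a b))).2 =
      collect [(codeVars L a).2, (codeVars L b).2] := by
  rw [← varsTable_pair_getD L (show 0 < 5 by decide) (Nat.left_le_pair a b) default,
    ← varsTable_pair_getD L (show 0 < 5 by decide) (Nat.right_le_pair a b) default]
  simp [codeVars, varsStep]

theorem codeVars_snd_qsup (a b : ℕ) :
    (codeVars L (Nat.pair 6 (Nat.pair a b))).2 =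
      (codeVars L b).2.map fun l => l.flatMap fun n => if n = a then [] else [n] := by
  rw [← varsTable_pair_getD L (show 0 < 6 by decide) (Nat.right_le_pair a b) default]
  simp [codeVars, varsStep]

theorem codeVars_snd_qinf (a b : ℕ) :
    (codeVars L (Nat.pair 7 (Nat.pair a b))).2 =
      (codeVars L b).2.map fun l => l.flatMap fun n => if n = a then [] else [n] := by
  rw [← varsTable_pair_getD L (show 0 < 7 by decide) (Nat.right_le_pair a b) default]
  simp [codeVars, varsStep]

theorem codeVars_snd_of_eight_le {t : ℕ} (ht : 8 ≤ t) (r : ℕ) :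
    (codeVars L (Nat.pair t r)).2 = none := by
  have : ∀ i < 8, t ≠ i := fun i hi => by omega
  simp [codeVars, varsStep, this]

end codeVars

end CLPaper

namespace CLPaper

theorem Term.godel_func (f : ℕ) (args : List Term) :
    (Term.func f args).godel =
      Nat.pair 1 (Nat.pair f (Encodable.encode (args.map Term.godel))) := by
  rw [Term.godel, List.attach_map_val]

theorem Term.godel_var (n : ℕ) : (Term.var n).godel = Nat.pair 0 n := by
  rw [Term.godel]

theorem eq_of_map_eq_map_of_mem {α β : Type*} {f : α → β} {l l' : List α}
    (h : ∀ x ∈ l, ∀ y, f x = f y → x = y) (e : l.map f = l'.map f) : l = l' := by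
  induction l generalizing l' with
  | nil => cases l' <;> simp_all
  | cons a l ih =>
    rcases l' with _ | ⟨b, l'⟩
    · simp at e
    · simp only [List.map_cons, List.cons.injEq] at e
      rw [h a (by simp) b e.1, ih (fun x hx => h x (by simp [hx])) e.2]

theorem Term.godel_lt_of_mem {f : ℕ} {args : List Term} {t : Term} (ht : t ∈ args) :
    t.godel < (Term.func f args).godel := by
  rw [Term.godel_func]
  have := lt_of_mem_ofNat_list (n := Encodable.encode (args.map Term.godel)) (i := t.godel)
    (by simpa using ⟨t, ht, rfl⟩)
  have := Nat.right_le_pair f (Encodable.encode (args.map Term.godel))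
  have := Nat.right_le_pair 1 (Nat.pair f (Encodable.encode (args.map Term.godel)))
  omega

theorem Term.godel_injective : Function.Injective Term.godel := by
  suffices ∀ n, ∀ t s : Term, t.godel = n → t.godel = s.godel → t = s from
    fun t s h => this _ t s rfl h
  intro n
  induction n using Nat.strong_induction_on with
  | _ n ih =>
    rintro (a | ⟨f, l⟩) (b | ⟨g, m⟩) hn h
    · simpa [Term.godel_var] using h
    · simp [Term.godel_var, Term.godel_func] at h
    · simp [Term.godel_var, Term.godel_func] at h
    · have hl : ∀ t ∈ l, ∀ s, t.godel = s.godel → t = s := fun t ht s hs =>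
        ih _ (hn ▸ Term.godel_lt_of_mem ht) t s rfl hs
      simp only [Term.godel_func, Nat.pair_eq_pair, true_and, Encodable.encode_inj] at h
      rw [h.1, eq_of_map_eq_map_of_mem hl h.2]

theorem Formula.godel_injective : Function.Injective Formula.godel := by
  intro φ
  induction φ with
  | pred P l =>
    rintro (_ | _) h <;> simp_all [Formula.godel,
      (List.map_injective_iff.2 Term.godel_injective).eq_iff]
  | _ =>
    rintro (_ | _) h <;> simp_all [Formula.godel, Term.godel_injective.eq_iff] <;> aesop

theorem collect_cons (o : Option (List ℕ)) (l : List (Option (List ℕ))) (w : List ℕ) :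
    collect (o :: l) = some w ↔ ∃ u v, o = some u ∧ collect l = some v ∧ u ++ v = w := by
  change (o.bind fun a => (collect l).map fun b => a ++ b) = some w ↔ _
  cases o <;> simp

theorem collect_nil : collect [] = some [] := rfl

theorem collect_pair (o p : Option (List ℕ)) (w : List ℕ) :
    collect [o, p] = some w ↔ ∃ u v, o = some u ∧ p = some v ∧ u ++ v = w := by
  simp [collect_cons, collect_nil]

section codeVars

variable {L : CLang}

theorem exists_terms_of_collect {l w : List ℕ}
    (h : ∀ i ∈ l, ∀ u, (codeVars L i).1 = some u →
      ∃ t : Term, t.WF L ∧ t.godel = i ∧ ∀ n, n ∈ u ↔ t.HasVar n)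
    (hw : collect (l.map fun i => (codeVars L i).1) = some w) :
    ∃ ts : List Term, (∀ t ∈ ts, t.WF L) ∧ ts.map Term.godel = l ∧
      ∀ n, n ∈ w ↔ ∃ t ∈ ts, t.HasVar n := by
  induction l generalizing w with
  | nil => exact ⟨[], by simp, rfl, by simp_all [collect_nil]⟩
  | cons i l ih =>
    rw [List.map_cons, collect_cons] at hw
    obtain ⟨u, v, hu, hv, rfl⟩ := hw
    obtain ⟨t, ht, hti, htn⟩ := h i (by simp) u hu
    obtain ⟨ts, hts, htsl, htsn⟩ := ih (fun i hi => h i (by simp [hi])) hv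
    exact ⟨t :: ts, by simpa using ⟨ht, hts⟩, by simp [hti, htsl], by simp [htn, htsn]⟩

theorem exists_collect_of_terms {ts : List Term}
    (h : ∀ t ∈ ts, ∃ u, (codeVars L t.godel).1 = some u ∧ ∀ n, n ∈ u ↔ t.HasVar n) :
    ∃ w, collect ((ts.map Term.godel).map fun i => (codeVars L i).1) = some w ∧
      ∀ n, n ∈ w ↔ ∃ t ∈ ts, t.HasVar n := by
  induction ts with
  | nil => exact ⟨[], rfl, by simp⟩
  | cons t ts ih =>
    obtain ⟨u, hu, hun⟩ := h t (by simp)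
    obtain ⟨v, hv, hvn⟩ := ih fun t ht => h t (by simp [ht])
    exact ⟨u ++ v, (collect_cons _ _ _).2 ⟨u, v, hu, hv, rfl⟩, by simp [hun, hvn]⟩

theorem Term.hasVar_var {m n : ℕ} : (Term.var m).HasVar n ↔ n = m :=
  ⟨fun h => by cases h; rfl, fun h => h ▸ .var⟩

theorem Term.hasVar_func {f n : ℕ} {args : List Term} :
    (Term.func f args).HasVar n ↔ ∃ t ∈ args, t.HasVar n :=
  ⟨fun h => by cases h with | func _ _ t ht h => exact ⟨t, ht, h⟩,
    fun ⟨t, ht, h⟩ => .func f args t ht h⟩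

theorem exists_term_of_codeVars (k : ℕ) (w : List ℕ) (h : (codeVars L k).1 = some w) :
    ∃ t : Term, t.WF L ∧ t.godel = k ∧ ∀ n, n ∈ w ↔ t.HasVar n := by
  induction k using Nat.strong_induction_on generalizing w with
  | _ k ih =>
    obtain ⟨t, r, rfl⟩ : ∃ t r, k = Nat.pair t r := ⟨_, _, (Nat.pair_unpair k).symm⟩
    rcases t with _ | _ | t
    · rw [codeVars_fst_var] at h
      obtain rfl := Option.some.inj h
      exact ⟨.var r, .var r, Term.godel_var r, by simp [Term.hasVar_var]⟩
    · obtain ⟨f, l, rfl⟩ : ∃ f, ∃ l : List ℕ, r = Nat.pair f (Encodable.encode l) :=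
        ⟨r.unpair.1, Denumerable.ofNat (List ℕ) r.unpair.2, by simp⟩
      simp only [zero_add] at h ih ⊢
      rw [codeVars_fst_func] at h
      split_ifs at h with har
      obtain ⟨ts, hts, rfl, htsn⟩ := exists_terms_of_collect (fun i hi u hu => ih i (by
        have := lt_of_mem_ofNat_list (n := Encodable.encode l) (i := i) (by simpa using hi)
        have := Nat.right_le_pair f (Encodable.encode l)
        have := Nat.right_le_pair 1 (Nat.pair f (Encodable.encode l))
        omega) u hu) h
      exact ⟨.func f ts, .func f ts (by simpa using har) hts, Term.godel_func f ts,
        by simp [htsn, Term.hasVar_func]⟩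
    · simp [codeVars_fst_of_two_le] at h

theorem Term.WF.exists_codeVars {t : Term} (ht : t.WF L) :
    ∃ u, (codeVars L t.godel).1 = some u ∧ ∀ n, n ∈ u ↔ t.HasVar n := by
  induction ht with
  | var m => exact ⟨[m], by rw [Term.godel_var, codeVars_fst_var], by simp [Term.hasVar_var]⟩
  | func f args har _ ih =>
    obtain ⟨w, hw, hwn⟩ := exists_collect_of_terms ih
    refine ⟨w, ?_, by simp [hwn, Term.hasVar_func]⟩
    rw [Term.godel_func, codeVars_fst_func, if_pos (by simpa using har), hw]

namespace Formula

variable {n : ℕ}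

theorem freeIn_pred {P : ℕ} {args : List Term} :
    (pred P args).FreeIn n ↔ ∃ t ∈ args, t.HasVar n :=
  ⟨fun h => by cases h with | pred _ _ t ht h => exact ⟨t, ht, h⟩,
    fun ⟨t, ht, h⟩ => .pred P args t ht h⟩

theorem freeIn_dmetric {t s : Term} : (dmetric t s).FreeIn n ↔ t.HasVar n ∨ s.HasVar n :=
  ⟨fun h => by cases h <;> tauto, fun h => h.elim (.dmetric_left t s) (.dmetric_right t s)⟩

theorem freeIn_half {φ : Formula} : (half φ).FreeIn n ↔ φ.FreeIn n :=
  ⟨fun h => by cases h; assumption, .half φ⟩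

theorem freeIn_dotminus {φ ψ : Formula} : (dotminus φ ψ).FreeIn n ↔ φ.FreeIn n ∨ ψ.FreeIn n :=
  ⟨fun h => by cases h <;> tauto, fun h => h.elim (.dotminus_left φ ψ) (.dotminus_right φ ψ)⟩

theorem freeIn_qsup {m : ℕ} {φ : Formula} : (qsup m φ).FreeIn n ↔ m ≠ n ∧ φ.FreeIn n :=
  ⟨fun h => by cases h; tauto, fun h => .qsup m φ h.1 h.2⟩

theorem freeIn_qinf {m : ℕ} {φ : Formula} : (qinf m φ).FreeIn n ↔ m ≠ n ∧ φ.FreeIn n :=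
  ⟨fun h => by cases h; tauto, fun h => .qinf m φ h.1 h.2⟩

theorem not_freeIn_zero : ¬ zero.FreeIn n := fun h => by cases h

theorem not_freeIn_one : ¬ one.FreeIn n := fun h => by cases h

end Formula

open Formula

theorem mem_flatMap_ne {l : List ℕ} {a n : ℕ} :
    (n ∈ l.flatMap fun n => if n = a then [] else [n]) ↔ a ≠ n ∧ n ∈ l := by
  simp only [List.mem_flatMap]
  constructor
  · rintro ⟨x, hx, h⟩
    split_ifs at h with hxa
    · simp at h
    · obtain rfl : n = x := by simpa using h
      exact ⟨fun h => hxa h.symm, hx⟩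
  · rintro ⟨h, hn⟩
    exact ⟨n, hn, by rw [if_neg (Ne.symm h)]; simp⟩

theorem exists_formula_of_codeVars (k : ℕ) (w : List ℕ) (h : (codeVars L k).2 = some w) :
    ∃ φ : Formula, φ.WF L ∧ φ.godel = k ∧ ∀ n, n ∈ w ↔ φ.FreeIn n := by
  induction k using Nat.strong_induction_on generalizing w with
  | _ k ih =>
    obtain ⟨t, r, rfl⟩ : ∃ t r, k = Nat.pair t r := ⟨_, _, (Nat.pair_unpair k).symm⟩
    have lt_right : 0 < t → r < Nat.pair t r := fun ht => by
      have := Nat.add_le_pair t r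
      omega
    obtain ⟨a, b, hr⟩ : ∃ a b, r = Nat.pair a b := ⟨_, _, (Nat.pair_unpair r).symm⟩
    have ha : a ≤ r := hr ▸ Nat.left_le_pair a b
    have hb : b ≤ r := hr ▸ Nat.right_le_pair a b
    obtain _ | _ | _ | _ | _ | _ | _ | _ | t := t
    · obtain ⟨l, rfl⟩ : ∃ l : List ℕ, b = Encodable.encode l :=
        ⟨Denumerable.ofNat (List ℕ) b, by simp⟩
      rw [hr, codeVars_snd_pred] at h
      split_ifs at h with har
      obtain ⟨ts, hts, rfl, htsn⟩ := exists_terms_of_collect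
        (fun i _ u hu => exists_term_of_codeVars i u hu) h
      exact ⟨.pred a ts, .pred a ts (by simpa using har) hts, by rw [hr, godel],
        by simp [htsn, freeIn_pred]⟩
    · rw [hr, zero_add, codeVars_snd_dmetric, collect_pair] at h
      obtain ⟨u, v, hu, hv, rfl⟩ := h
      obtain ⟨t, ht, rfl, htn⟩ := exists_term_of_codeVars _ _ hu
      obtain ⟨s, hs, rfl, hsn⟩ := exists_term_of_codeVars _ _ hv
      exact ⟨.dmetric t s, .dmetric t s ht hs, by rw [hr, godel],
        by simp [htn, hsn, freeIn_dmetric]⟩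
    · simp only [zero_add, Nat.reduceAdd] at h ⊢
      rw [codeVars_snd_zero] at h
      split_ifs at h with h0
      obtain rfl := Option.some.inj h
      exact ⟨.zero, .zero, by rw [h0, godel], by simp [not_freeIn_zero]⟩
    · simp only [zero_add, Nat.reduceAdd] at h ⊢
      rw [codeVars_snd_one] at h
      split_ifs at h with h0
      obtain rfl := Option.some.inj h
      exact ⟨.one, .one, by rw [h0, godel], by simp [not_freeIn_one]⟩
    · have hlt := lt_right (by omega)
      simp only [zero_add, Nat.reduceAdd] at h ih hlt ⊢
      rw [codeVars_snd_half] at h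
      obtain ⟨φ, hφ, rfl, hn⟩ := ih r hlt w h
      exact ⟨.half φ, .half φ hφ, by rw [godel], by simp [hn, freeIn_half]⟩
    · have hlt := lt_right (by omega)
      simp only [zero_add, Nat.reduceAdd] at h ih hlt ⊢
      rw [hr, codeVars_snd_dotminus, collect_pair] at h
      obtain ⟨u, v, hu, hv, rfl⟩ := h
      obtain ⟨φ, hφ, rfl, hφn⟩ := ih a (ha.trans_lt hlt) u hu
      obtain ⟨ψ, hψ, rfl, hψn⟩ := ih b (hb.trans_lt hlt) v hv
      exact ⟨.dotminus φ ψ, .dotminus φ ψ hφ hψ, by rw [hr, godel],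
        by simp [hφn, hψn, freeIn_dotminus]⟩
    · have hlt := lt_right (by omega)
      simp only [zero_add, Nat.reduceAdd] at h ih hlt ⊢
      rw [hr, codeVars_snd_qsup, Option.map_eq_some_iff] at h
      obtain ⟨u, hu, rfl⟩ := h
      obtain ⟨φ, hφ, rfl, hφn⟩ := ih b (hb.trans_lt hlt) u hu
      exact ⟨.qsup a φ, .qsup a φ hφ, by rw [hr, godel],
        by simp only [mem_flatMap_ne, freeIn_qsup, hφn, implies_true]⟩
    · have hlt := lt_right (by omega)
      simp only [zero_add, Nat.reduceAdd] at h ih hlt ⊢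
      rw [hr, codeVars_snd_qinf, Option.map_eq_some_iff] at h
      obtain ⟨u, hu, rfl⟩ := h
      obtain ⟨φ, hφ, rfl, hφn⟩ := ih b (hb.trans_lt hlt) u hu
      exact ⟨.qinf a φ, .qinf a φ hφ, by rw [hr, godel],
        by simp only [mem_flatMap_ne, freeIn_qinf, hφn, implies_true]⟩
    · rw [codeVars_snd_of_eight_le L (by omega)] at h
      simp at h

theorem Formula.WF.exists_codeVars {φ : Formula} (hφ : φ.WF L) :
    ∃ u, (codeVars L φ.godel).2 = some u ∧ ∀ n, n ∈ u ↔ φ.FreeIn n := by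
  induction hφ with
  | pred P args har ht =>
    obtain ⟨w, hw, hwn⟩ := exists_collect_of_terms fun t h => (ht t h).exists_codeVars
    refine ⟨w, ?_, by simp [hwn, freeIn_pred]⟩
    rw [godel, codeVars_snd_pred, if_pos (by simpa using har), hw]
  | dmetric t s ht hs =>
    obtain ⟨u, hu, hun⟩ := ht.exists_codeVars
    obtain ⟨v, hv, hvn⟩ := hs.exists_codeVars
    exact ⟨u ++ v, by rw [godel, codeVars_snd_dmetric, collect_pair]; exact ⟨u, v, hu, hv, rfl⟩,
      by simp [hun, hvn, freeIn_dmetric]⟩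
  | zero => exact ⟨[], by rw [godel, codeVars_snd_zero, if_pos rfl], by simp [not_freeIn_zero]⟩
  | one => exact ⟨[], by rw [godel, codeVars_snd_one, if_pos rfl], by simp [not_freeIn_one]⟩
  | half φ _ ih =>
    obtain ⟨u, hu, hun⟩ := ih
    exact ⟨u, by rw [godel, codeVars_snd_half, hu], by simp [hun, freeIn_half]⟩
  | dotminus φ ψ _ _ ihφ ihψ =>
    obtain ⟨u, hu, hun⟩ := ihφ
    obtain ⟨v, hv, hvn⟩ := ihψ
    exact ⟨u ++ v, by rw [godel, codeVars_snd_dotminus, collect_pair]; exact ⟨u, v, hu, hv, rfl⟩,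
      by simp [hun, hvn, freeIn_dotminus]⟩
  | qsup m φ _ ih =>
    obtain ⟨u, hu, hun⟩ := ih
    exact ⟨_, by rw [godel, codeVars_snd_qsup, hu, Option.map_some],
      by simp only [mem_flatMap_ne, freeIn_qsup, hun, implies_true]⟩
  | qinf m φ _ ih =>
    obtain ⟨u, hu, hun⟩ := ih
    exact ⟨_, by rw [godel, codeVars_snd_qinf, hu, Option.map_some],
      by simp only [mem_flatMap_ne, freeIn_qinf, hun, implies_true]⟩

theorem codeVars_eq_nil_iff {k : ℕ} :
    (codeVars L k).2 = some [] ↔ ∃ φ : Formula, φ.IsSentence L ∧ φ.godel = k := by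
  constructor
  · intro h
    obtain ⟨φ, hφ, hk, hn⟩ := exists_formula_of_codeVars k [] h
    exact ⟨φ, ⟨hφ, fun n => by simp [← hn]⟩, hk⟩
  · rintro ⟨φ, ⟨hφ, hc⟩, rfl⟩
    obtain ⟨u, hu, hn⟩ := hφ.exists_codeVars
    rw [hu, List.eq_nil_iff_forall_not_mem.2 fun n h => hc n ((hn n).1 h)]

end codeVars

/-- The set of codes of sentences of a computable language is decidable. -/
theorem CLang.IsComputable.exists_sentence_decider {L : CLang} (hL : L.IsComputable) :
    ∃ f : ℕ → ℕ, Computable f ∧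
      (∀ k, f k = 0 ↔ ¬ ∃ φ : Formula, φ.IsSentence L ∧ φ.godel = k) := by
  refine ⟨fun k => if (codeVars L k).2 = some [] then 1 else 0, ?_, fun k => ?_⟩
  · have : Primrec fun o : Option (List ℕ) => if o = some [] then 1 else 0 :=
      Primrec.ite (Primrec.eq.comp Primrec.id (Primrec.const _)) (Primrec.const 1)
        (Primrec.const 0)
    exact this.to_comp.comp (Computable.snd.comp hL.computable_codeVars)
  · simp [← codeVars_eq_nil_iff]

end CLPaper

namespace CLPaper

theorem encode_rat (q : ℚ) : Encodable.encode q = Nat.pair (Encodable.encode q.num) q.den := rfl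

theorem encode_int_ofNat (n : ℕ) : Encodable.encode (n : ℤ) = 2 * n := rfl

theorem encode_int_negSucc (n : ℕ) : Encodable.encode (Int.negSucc n) = 2 * n + 1 := rfl

theorem int_pos_iff_encode (z : ℤ) :
    0 < z ↔ 0 < Encodable.encode z ∧ Encodable.encode z % 2 = 0 := by
  rcases z with n | n
  · rw [Int.ofNat_eq_natCast, encode_int_ofNat]
    omega
  · rw [encode_int_negSucc]
    omega

theorem int_neg_iff_encode (z : ℤ) : z < 0 ↔ Encodable.encode z % 2 = 1 := by
  rcases z with n | n
  · rw [Int.ofNat_eq_natCast, encode_int_ofNat]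
    omega
  · rw [encode_int_negSucc]
    omega

theorem encode_one_div_succ (m : ℕ) :
    Encodable.encode ((1 : ℚ) / ((m : ℚ) + 1)) = Nat.pair 2 (m + 1) := by
  have hpos : (0 : ℤ) < (m : ℤ) + 1 := by positivity
  have hcop : (1 : ℤ).natAbs.Coprime ((m : ℤ) + 1).natAbs := by simp
  have hnum := Rat.num_div_eq_of_coprime hpos hcop
  have hden := Rat.den_div_eq_of_coprime hpos hcop
  push_cast at hnum hden
  rw [encode_rat, hnum, show ((1 : ℚ) / ((m : ℚ) + 1)).den = m + 1 by exact_mod_cast hden]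
  rfl

/-- `1` if the code represents a rational interval not containing `0`, and `0` otherwise. -/
def excludesZero (w : ℕ) : ℕ :=
  if (0 < w.unpair.1.unpair.1 ∧ w.unpair.1.unpair.1 % 2 = 0) ∨ w.unpair.2.unpair.1 % 2 = 1
  then 1 else 0

theorem primrec_excludesZero : Primrec excludesZero := by
  have l : Primrec fun w : ℕ => w.unpair.1.unpair.1 :=
    Primrec.fst.comp (Primrec.unpair.comp (Primrec.fst.comp Primrec.unpair))
  have r : Primrec fun w : ℕ => w.unpair.2.unpair.1 :=
    Primrec.fst.comp (Primrec.unpair.comp (Primrec.snd.comp Primrec.unpair))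
  have parity : ∀ {f : ℕ → ℕ} (i : ℕ), Primrec f → PrimrecPred fun w => f w % 2 = i :=
    fun i hf => Primrec.eq.comp (Primrec.nat_mod.comp hf (Primrec.const 2)) (Primrec.const i)
  exact Primrec.ite (((Primrec.nat_lt.comp (Primrec.const 0) l).and (parity 0 l)).or (parity 1 r))
    (Primrec.const 1) (Primrec.const 0)

theorem excludesZero_encode (a b : ℚ) :
    excludesZero (Encodable.encode (a, b)) = if 0 < a ∨ b < 0 then 1 else 0 := by
  rw [Encodable.encode_prod_val, encode_rat, encode_rat]
  simp only [excludesZero, Nat.unpair_pair, ← int_pos_iff_encode, ← int_neg_iff_encode,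
    Rat.num_pos, Rat.num_neg]

theorem Formula.IsSentence.godel_mem_thSet_iff {L : CLang} {M : Type*} [MetricSpace M]
    [Nonempty M] {S : CStruct M} {φ : Formula} (hφ : φ.IsSentence L) :
    φ.godel ∈ thSet L S ↔ S.sval φ = 0 := by
  refine ⟨?_, fun h => ⟨φ, hφ, rfl, h⟩⟩
  rintro ⟨ψ, -, hψ, h⟩
  exact Formula.godel_injective hψ ▸ h

theorem ThComputableIn.piIn_thSet {L : CLang} (hL : L.IsComputable) {M : Type*} [MetricSpace M]
    [Nonempty M] {S : CStruct M} {d : ℕ → Bool} (h : ThComputableIn d L S) :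
    PiIn d 1 (thSet L S) := by
  obtain ⟨F, hF, hspec⟩ := h
  obtain ⟨g, hg⟩ := hF.exists_isStaging
  obtain ⟨dec, hdec, hdec_iff⟩ := hL.exists_sentence_decider
  let t : ℕ → ℕ := fun n => Nat.casesOn (motive := fun _ => ℕ)
      (g (Nat.pair n.unpair.1 (Nat.pair 2 (n.unpair.2.unpair.1 + 1))) n.unpair.2.unpair.2) 1
      fun w => 1 - excludesZero w
  let f : ℕ → ℕ := fun n => Nat.casesOn (motive := fun _ => ℕ) (dec n.unpair.1) 0 fun _ => t n
  have hf : ComputableIn d f := by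
    have succ : ComputableIn d fun n => n + 1 := .of_computable Computable.succ
    have ht : ComputableIn d t := by
      refine .natCases (h := fun _ w => 1 - excludesZero w) (.const 1) ?_ ?_
      · exact hg.computable.comp (.pair .left (.pair (.const 2) (succ.comp (.comp .left .right))))
          (.comp .right .right)
      · exact ComputableIn.comp (f := fun w => 1 - excludesZero w) (.of_computable
          (Primrec.nat_sub.comp (Primrec.const 1) primrec_excludesZero).to_comp) .right
    exact .natCases (h := fun n _ => t n) (.const 0)
      ((ComputableIn.of_computable hdec).comp .left) (ComputableIn.comp ht .left)
  refine ⟨{n | f n ≠ 1}, ⟨f, hf, fun n => by simp⟩, ?_⟩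
  ext k
  by_cases hk : ∃ φ : Formula, φ.IsSentence L ∧ φ.godel = k
  · obtain ⟨φ, hφ, rfl⟩ := hk
    have hd : dec φ.godel ≠ 0 := fun h => (hdec_iff _).1 h ⟨φ, hφ, rfl⟩
    obtain ⟨c, hc⟩ := Nat.exists_eq_succ_of_ne_zero hd
    have hfy : ∀ m s, f (Nat.pair φ.godel (Nat.pair m s)) ≠ 1 ↔
        ∃ w, g (Nat.pair φ.godel (Nat.pair 2 (m + 1))) s = w + 1 ∧ excludesZero w = 1 := by
      intro m s
      simp only [f, t, Nat.unpair_pair, hc]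
      rcases g (Nat.pair φ.godel (Nat.pair 2 (m + 1))) s with _ | w
      · simp
      · have hw : excludesZero w = 0 ∨ excludesZero w = 1 := by
          unfold excludesZero
          split_ifs <;> simp
        rcases hw with h | h <;> simp [h]
    rw [Set.mem_compl_iff, hφ.godel_mem_thSet_iff]
    constructor
    · intro hv
      obtain ⟨m, hm⟩ := exists_nat_one_div_lt (abs_pos.2 hv)
      obtain ⟨a, b, hFab, hab, ha, hb⟩ := hspec φ hφ (1 / ((m : ℚ) + 1)) (by positivity)
      rw [encode_one_div_succ] at hFab
      obtain ⟨s, hs⟩ := hg.mem_iff.1 (hFab ▸ Part.mem_some _)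
      refine ⟨Nat.pair m s, (hfy m s).2 ⟨_, hs, ?_⟩⟩
      rw [excludesZero_encode, if_pos]
      push_cast at hab
      rcases lt_abs.1 hm with h | h
      · left
        exact_mod_cast (by linarith : (0 : ℝ) < a)
      · right
        exact_mod_cast (by linarith : (b : ℝ) < 0)
    · rintro ⟨y, hy⟩
      rw [← Nat.pair_unpair y] at hy
      obtain ⟨w, hw, hw1⟩ := (hfy _ _).1 hy
      obtain ⟨a, b, hFab, -, ha, hb⟩ := hspec φ hφ (1 / ((y.unpair.1 : ℚ) + 1)) (by positivity)
      rw [encode_one_div_succ] at hFab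
      have hw' := hg.mem_iff.2 ⟨_, hw⟩
      rw [hFab, Part.mem_some_iff] at hw'
      rw [hw', excludesZero_encode] at hw1
      intro h0
      rw [h0] at ha hb
      split_ifs at hw1 with h
      rcases h with h | h
      · exact absurd (by exact_mod_cast ha : a ≤ 0) (not_le.2 h)
      · exact absurd (by exact_mod_cast hb : 0 ≤ b) (not_le.2 h)
  · have h1 : k ∈ (thSet L S)ᶜ := fun ⟨φ, hφ, hk', _⟩ => hk ⟨φ, hφ, hk'⟩
    refine iff_of_true h1 ⟨0, ?_⟩
    simp [f, (hdec_iff k).2 hk]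

end CLPaper

namespace CLPaper

namespace Formula

/-- The sentence with constant value `2⁻ⁿ`. -/
def twoInvPow : ℕ → Formula
  | 0 => .one
  | n + 1 => .half (twoInvPow n)

/-- The formula with value `ψ ∸ j * 2⁻ⁿ`. -/
def subMul (ψ : Formula) (n : ℕ) : ℕ → Formula
  | 0 => ψ
  | j + 1 => .dotminus (subMul ψ n j) (twoInvPow n)

section

variable {L : CLang}

theorem isSentence_zero : zero.IsSentence L := ⟨.zero, fun _ => not_freeIn_zero⟩

theorem isSentence_one : one.IsSentence L := ⟨.one, fun _ => not_freeIn_one⟩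

theorem IsSentence.half {φ : Formula} (hφ : φ.IsSentence L) : (Formula.half φ).IsSentence L :=
  ⟨.half _ hφ.1, fun n h => hφ.2 n (freeIn_half.1 h)⟩

theorem IsSentence.dotminus {φ ψ : Formula} (hφ : φ.IsSentence L) (hψ : ψ.IsSentence L) :
    (Formula.dotminus φ ψ).IsSentence L :=
  ⟨.dotminus _ _ hφ.1 hψ.1, fun n h => (freeIn_dotminus.1 h).elim (hφ.2 n) (hψ.2 n)⟩

theorem isSentence_twoInvPow (n : ℕ) : (twoInvPow n).IsSentence L := by
  induction n with
  | zero => exact isSentence_one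
  | succ n ih => exact ih.half

theorem IsSentence.subMul {ψ : Formula} (hψ : ψ.IsSentence L) (n j : ℕ) :
    (ψ.subMul n j).IsSentence L := by
  induction j with
  | zero => exact hψ
  | succ j ih => exact ih.dotminus (isSentence_twoInvPow n)

end

end Formula

section

variable {M : Type*} [MetricSpace M] [Nonempty M] (S : CStruct M)

theorem CStruct.sval_zero : S.sval .zero = 0 := rfl

theorem CStruct.sval_one : S.sval .one = 1 := rfl

theorem CStruct.sval_half (φ : Formula) : S.sval (.half φ) = S.sval φ / 2 := rfl

theorem CStruct.sval_dotminus (φ ψ : Formula) :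
    S.sval (.dotminus φ ψ) = max (S.sval φ - S.sval ψ) 0 := rfl

theorem CStruct.sval_twoInvPow (n : ℕ) : S.sval (.twoInvPow n) = (1 / 2 : ℝ) ^ n := by
  induction n with
  | zero => simpa [Formula.twoInvPow] using S.sval_one
  | succ n ih =>
    rw [Formula.twoInvPow, S.sval_half, ih, pow_succ]
    ring

theorem CStruct.sval_subMul {ψ : Formula} (h : 0 ≤ S.sval ψ) (n j : ℕ) :
    S.sval (ψ.subMul n j) = max (S.sval ψ - j * (1 / 2 : ℝ) ^ n) 0 := by
  induction j with
  | zero => simpa [Formula.subMul] using h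
  | succ j ih =>
    rw [Formula.subMul, S.sval_dotminus, ih, S.sval_twoInvPow]
    have : (0 : ℝ) < (1 / 2 : ℝ) ^ n := by positivity
    push_cast
    rcases le_total (S.sval ψ - j * (1 / 2 : ℝ) ^ n) 0 with h1 | h1
    · rw [max_eq_right h1, max_eq_right (by linarith), max_eq_right (by linarith)]
    · rw [max_eq_left h1]
      congr 1
      ring

end

/-- The Gödel number of `Formula.twoInvPow n`. -/
def twoInvPowCode (n : ℕ) : ℕ :=
  Nat.rec (motive := fun _ => ℕ) (Nat.pair 3 0) (fun _ c => Nat.pair 4 c) n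

/-- The Gödel number of `Formula.subMul ψ n j` in terms of that of `ψ`. -/
def subMulCode (k n j : ℕ) : ℕ :=
  Nat.rec (motive := fun _ => ℕ) k (fun _ c => Nat.pair 5 (Nat.pair c (twoInvPowCode n))) j

/-- The Gödel number of a sentence which is nonzero if and only if `j = 0` or
`(j - 1) * 2⁻ⁿ < ψ`, where `k` is the Gödel number of `ψ`. -/
def lowerCode (k n j : ℕ) : ℕ :=
  Nat.casesOn (motive := fun _ => ℕ) j (Nat.pair 3 0) fun i => subMulCode k n i

/-- The Gödel number of a sentence which is nonzero if and only if `ψ < (j + 1) * 2⁻ⁿ`,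
where `k` is the Gödel number of `ψ`. -/
def upperCode (k n j : ℕ) : ℕ :=
  Nat.pair 5 (Nat.pair (twoInvPowCode n) (subMulCode k n j))

theorem godel_twoInvPow (n : ℕ) : (Formula.twoInvPow n).godel = twoInvPowCode n := by
  induction n with
  | zero => rfl
  | succ n ih => rw [Formula.twoInvPow, Formula.godel, ih]; rfl

theorem godel_subMul (ψ : Formula) (n j : ℕ) :
    (ψ.subMul n j).godel = subMulCode ψ.godel n j := by
  induction j with
  | zero => rfl
  | succ j ih => rw [Formula.subMul, Formula.godel, ih, godel_twoInvPow]; rfl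

theorem primrec_twoInvPowCode : Primrec twoInvPowCode :=
  (Primrec.nat_rec' Primrec.id (Primrec.const (Nat.pair 3 0))
    (h := fun _ p => Nat.pair 4 p.2)
    (Primrec₂.natPair.comp (Primrec.const 4) (Primrec.snd.comp Primrec.snd))).of_eq fun _ => rfl

theorem primrec_subMulCode {α : Type*} [Primcodable α] {k n j : α → ℕ} (hk : Primrec k)
    (hn : Primrec n) (hj : Primrec j) : Primrec fun a => subMulCode (k a) (n a) (j a) :=
  (Primrec.nat_rec' hj hk
    (h := fun a p => Nat.pair 5 (Nat.pair p.2 (twoInvPowCode (n a))))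
    (Primrec₂.natPair.comp (Primrec.const 5) (Primrec₂.natPair.comp
      (Primrec.snd.comp Primrec.snd)
      (primrec_twoInvPowCode.comp (hn.comp Primrec.fst))))).of_eq fun _ => rfl

theorem primrec_lowerCode {α : Type*} [Primcodable α] {k n j : α → ℕ} (hk : Primrec k)
    (hn : Primrec n) (hj : Primrec j) : Primrec fun a => lowerCode (k a) (n a) (j a) :=
  (Primrec.nat_casesOn hj (Primrec.const (Nat.pair 3 0))
    (Primrec₂.mk (f := fun a i => subMulCode (k a) (n a) i)
      (primrec_subMulCode (hk.comp Primrec.fst) (hn.comp Primrec.fst) Primrec.snd))).of_eq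
    fun _ => rfl

theorem primrec_upperCode {α : Type*} [Primcodable α] {k n j : α → ℕ} (hk : Primrec k)
    (hn : Primrec n) (hj : Primrec j) : Primrec fun a => upperCode (k a) (n a) (j a) :=
  Primrec₂.natPair.comp (Primrec.const 5) (Primrec₂.natPair.comp
    (primrec_twoInvPowCode.comp hn) (primrec_subMulCode hk hn hj))

section

variable {L : CLang} {M : Type*} [MetricSpace M] [Nonempty M] {S : CStruct M}

theorem lowerCode_notMem_thSet_iff {ψ : Formula} (hψ : ψ.IsSentence L) (h : 0 ≤ S.sval ψ)
    (n j : ℕ) :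
    lowerCode ψ.godel n j ∉ thSet L S ↔ j = 0 ∨ ((j : ℝ) - 1) * (1 / 2 : ℝ) ^ n < S.sval ψ := by
  rcases j with _ | i
  · have := (Formula.isSentence_one (L := L)).godel_mem_thSet_iff (S := S)
    rw [S.sval_one] at this
    simpa [lowerCode, Formula.godel] using this
  · rw [show lowerCode ψ.godel n (i + 1) = (ψ.subMul n i).godel from (godel_subMul ψ n i).symm,
      (hψ.subMul n i).godel_mem_thSet_iff, S.sval_subMul h, max_eq_right_iff]
    simp

theorem upperCode_notMem_thSet_iff {ψ : Formula} (hψ : ψ.IsSentence L) (h : 0 ≤ S.sval ψ)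
    (n j : ℕ) :
    upperCode ψ.godel n j ∉ thSet L S ↔ S.sval ψ < ((j : ℝ) + 1) * (1 / 2 : ℝ) ^ n := by
  have hc : upperCode ψ.godel n j =
      (Formula.dotminus (.twoInvPow n) (ψ.subMul n j)).godel := by
    rw [Formula.godel, godel_twoInvPow, godel_subMul]; rfl
  have : (0 : ℝ) < (1 / 2 : ℝ) ^ n := by positivity
  rw [hc, ((Formula.isSentence_twoInvPow n).dotminus (hψ.subMul n j)).godel_mem_thSet_iff,
    S.sval_dotminus, S.sval_subMul h, S.sval_twoInvPow, max_eq_right_iff, not_le, sub_pos,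
    max_lt_iff, and_iff_left this, sub_lt_iff_lt_add, add_mul, one_mul, add_comm]

theorem PiIn.exists_recursiveIn_approx {d : ℕ → Bool} (hd : PiIn d 1 (thSet L S)) :
    ∃ R : ℕ →. ℕ, RecursiveIn d R ∧ ∀ ψ : Formula, ψ.IsSentence L → 0 ≤ S.sval ψ → ∀ n,
      ∃ m, R (Nat.pair ψ.godel n) = Part.some m ∧
        |S.sval ψ - m.unpair.1 * (1 / 2 : ℝ) ^ n| ≤ (1 / 2 : ℝ) ^ n := by
  obtain ⟨B, ⟨f, hf, hB⟩, hA⟩ := hd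
  have hmem : ∀ k, k ∉ thSet L S ↔ ∃ s, f (Nat.pair k s) ≠ 1 := by
    intro k
    rw [← Set.mem_compl_iff, hA]
    exact exists_congr fun s => by rw [← not_iff_not, ← Set.mem_compl_iff, hB, not_not]
  let isOne : ℕ → ℕ := fun x => if x = 1 then 1 else 0
  let p : ℕ → ℕ → ℕ := fun a m =>
    isOne (f (Nat.pair (lowerCode a.unpair.1 a.unpair.2 m.unpair.1) m.unpair.2.unpair.1)) +
    isOne (f (Nat.pair (upperCode a.unpair.1 a.unpair.2 m.unpair.1) m.unpair.2.unpair.2))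
  have hp_iff : ∀ a m, p a m = 0 ↔
      f (Nat.pair (lowerCode a.unpair.1 a.unpair.2 m.unpair.1) m.unpair.2.unpair.1) ≠ 1 ∧
      f (Nat.pair (upperCode a.unpair.1 a.unpair.2 m.unpair.1) m.unpair.2.unpair.2) ≠ 1 := by
    intro a m
    simp [p, isOne]
  have hp : ComputableIn₂ d p := by
    have primrec_left : Primrec fun n : ℕ => n.unpair.1 := Primrec.fst.comp Primrec.unpair
    have primrec_right : Primrec fun n : ℕ => n.unpair.2 := Primrec.snd.comp Primrec.unpair
    have hone : Primrec isOne :=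
      Primrec.ite (Primrec.eq.comp Primrec.id (Primrec.const 1)) (Primrec.const 1)
        (Primrec.const 0)
    have hadd : ComputableIn₂ d fun x y => x + y := .of_computable Primrec.nat_add.to_comp
    have hg : ComputableIn d fun x => isOne (f x) :=
      ComputableIn.comp (.of_computable hone.to_comp) hf
    have hl := primrec_lowerCode (primrec_left.comp primrec_left) (primrec_right.comp primrec_left) (primrec_left.comp primrec_right)
    have hu := primrec_upperCode (primrec_left.comp primrec_left) (primrec_right.comp primrec_left) (primrec_left.comp primrec_right)
    exact hadd.comp
      (hg.comp (.pair (.of_computable hl.to_comp)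
        (.of_computable (primrec_left.comp (primrec_right.comp primrec_right)).to_comp)))
      (hg.comp (.pair (.of_computable hu.to_comp)
        (.of_computable (primrec_right.comp (primrec_right.comp primrec_right)).to_comp)))
  refine ⟨_, RecursiveIn.rfind hp, fun ψ hψ h n => ?_⟩
  set v := S.sval ψ
  set δ : ℝ := (1 / 2 : ℝ) ^ n with hδ
  have hδ0 : 0 < δ := by positivity
  have hdom : (Nat.rfind fun m => Part.some (decide (p (Nat.pair ψ.godel n) m = 0))).Dom := by
    have h1 : (⌊v / δ⌋₊ : ℝ) * δ ≤ v :=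
      (le_div_iff₀ hδ0).1 (Nat.floor_le (div_nonneg h hδ0.le))
    have h2 : v < ((⌊v / δ⌋₊ : ℝ) + 1) * δ := (div_lt_iff₀ hδ0).1 (Nat.lt_floor_add_one _)
    obtain ⟨s, hs⟩ := (hmem _).1 ((lowerCode_notMem_thSet_iff hψ h n ⌊v / δ⌋₊).2
      (.inr (by linarith)))
    obtain ⟨t, ht⟩ := (hmem _).1 ((upperCode_notMem_thSet_iff hψ h n ⌊v / δ⌋₊).2 h2)
    refine Nat.rfind_dom.2 ⟨Nat.pair ⌊v / δ⌋₊ (Nat.pair s t), ?_, fun _ => trivial⟩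
    simpa [hp_iff] using And.intro hs ht
  obtain ⟨m, hm⟩ := Part.dom_iff_mem.1 hdom
  refine ⟨m, Part.eq_some_iff.2 hm, ?_⟩
  have h0 : p (Nat.pair ψ.godel n) m = 0 := by simpa using (Nat.mem_rfind.1 hm).1
  rw [hp_iff] at h0
  simp only [Nat.unpair_pair] at h0
  have hl := (lowerCode_notMem_thSet_iff hψ h n m.unpair.1).1 ((hmem _).2 ⟨_, h0.1⟩)
  have hu := (upperCode_notMem_thSet_iff hψ h n m.unpair.1).1 ((hmem _).2 ⟨_, h0.2⟩)
  rw [abs_le]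
  refine ⟨?_, by linarith⟩
  rcases hl with hl | hl
  · simp only [hl, Nat.cast_zero]
    linarith
  · linarith

end

/-- The code of the integer `x - y`. -/
def encodeSub (x y : ℕ) : ℕ := if y ≤ x then 2 * (x - y) else 2 * (y - x - 1) + 1

theorem encodeSub_eq (x y : ℕ) : encodeSub x y = Encodable.encode ((x : ℤ) - y) := by
  unfold encodeSub
  split_ifs with h
  · rw [← encode_int_ofNat, Nat.cast_sub h]
  · rw [← encode_int_negSucc, Int.negSucc_eq]
    congr 1
    omega

theorem primrec_encodeSub {α : Type*} [Primcodable α] {x y : α → ℕ} (hx : Primrec x)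
    (hy : Primrec y) : Primrec fun a => encodeSub (x a) (y a) :=
  Primrec.ite (Primrec.nat_le.comp hy hx)
    (Primrec.nat_mul.comp (Primrec.const 2) (Primrec.nat_sub.comp hx hy))
    (Primrec.succ.comp (Primrec.nat_mul.comp (Primrec.const 2)
      (Primrec.nat_sub.comp (Primrec.nat_sub.comp hy hx) (Primrec.const 1))))

theorem encode_dyadic {x y : ℕ} (h : Odd ((x : ℤ) - y)) (t : ℕ) :
    Encodable.encode (((x : ℚ) - y) / 2 ^ t) = Nat.pair (encodeSub x y) (2 ^ t) := by
  have hpos : (0 : ℤ) < 2 ^ t := by positivity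
  have hcop : ((x : ℤ) - y).natAbs.Coprime ((2 : ℤ) ^ t).natAbs := by
    rw [Int.natAbs_pow]
    exact Nat.Coprime.pow_right _ (Nat.coprime_two_right.2 (Int.natAbs_odd.2 h))
  have hnum := Rat.num_div_eq_of_coprime hpos hcop
  have hden := Rat.den_div_eq_of_coprime hpos hcop
  push_cast at hnum hden
  rw [encode_rat, hnum, encodeSub_eq]
  congr 1
  exact_mod_cast hden

theorem inv_encode_le {ε : ℚ} (hε : 0 < ε) : 1 / (Encodable.encode ε : ℚ) ≤ ε := by
  have hden : (0 : ℚ) < ε.den := by exact_mod_cast ε.pos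
  have hle : (ε.den : ℚ) ≤ (Encodable.encode ε : ℚ) := by
    rw [encode_rat]
    exact_mod_cast Nat.right_le_pair _ _
  have hnum : (1 : ℚ) ≤ ε.num := by exact_mod_cast Int.add_one_le_iff.2 (Rat.num_pos.2 hε)
  calc 1 / (Encodable.encode ε : ℚ) ≤ 1 / ε.den := one_div_le_one_div_of_le hden hle
    _ ≤ ε.num / ε.den := by gcongr
    _ = ε := Rat.num_div_den ε

/-- The code of the rational interval with centre `(i - j) * 2⁻⁽ᵉ⁺³⁾` and
length `5 * 2⁻⁽ᵉ⁺³⁾`. -/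
def intervalCode (i j e : ℕ) : ℕ :=
  Nat.pair (Nat.pair (encodeSub (2 * i) (2 * j + 5)) (2 ^ (e + 4)))
    (Nat.pair (encodeSub (2 * i + 5) (2 * j)) (2 ^ (e + 4)))

theorem intervalCode_eq (i j e : ℕ) : intervalCode i j e =
    Encodable.encode ((((2 * i : ℕ) : ℚ) - (2 * j + 5 : ℕ)) / 2 ^ (e + 4),
      (((2 * i + 5 : ℕ) : ℚ) - (2 * j : ℕ)) / 2 ^ (e + 4)) := by
  rw [Encodable.encode_prod_val, encode_dyadic, encode_dyadic]
  · rfl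
  · exact ⟨i - j + 2, by push_cast; ring⟩
  · exact ⟨i - j - 3, by push_cast; ring⟩

theorem primrec_intervalCode {α : Type*} [Primcodable α] {i j e : α → ℕ} (hi : Primrec i)
    (hj : Primrec j) (he : Primrec e) : Primrec fun a => intervalCode (i a) (j a) (e a) := by
  have dbl : ∀ {x : α → ℕ}, Primrec x → Primrec fun a => 2 * x a :=
    fun hx => Primrec.nat_mul.comp (Primrec.const 2) hx
  have hadd : ∀ {x : α → ℕ} (c : ℕ), Primrec x → Primrec fun a => x a + c :=
    fun c hx => Primrec.nat_add.comp hx (Primrec.const c)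
  have pow : Primrec fun a => 2 ^ (e a + 4) :=
    (Primrec₂.unpaired'.1 Nat.Primrec.pow).comp (Primrec.const 2) (hadd 4 he)
  exact Primrec₂.natPair.comp
    (Primrec₂.natPair.comp (primrec_encodeSub (dbl hi) (hadd 5 (dbl hj))) pow)
    (Primrec₂.natPair.comp (primrec_encodeSub (hadd 5 (dbl hi)) (dbl hj)) pow)

theorem PiIn.thComputableIn {L : CLang} {M : Type*} [MetricSpace M] [Nonempty M]
    {S : CStruct M} {d : ℕ → Bool} (hd : PiIn d 1 (thSet L S)) : ThComputableIn d L S := by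
  obtain ⟨R, hR, hspec⟩ := hd.exists_recursiveIn_approx
  let pos : ℕ → ℕ := fun a =>
    Nat.pair (Nat.pair 5 (Nat.pair a.unpair.1 (Nat.pair 2 0))) (a.unpair.2 + 3)
  let neg : ℕ → ℕ := fun a =>
    Nat.pair (Nat.pair 5 (Nat.pair (Nat.pair 2 0) a.unpair.1)) (a.unpair.2 + 3)
  let post : ℕ → ℕ := fun x =>
    intervalCode x.unpair.1.unpair.1.unpair.1 x.unpair.1.unpair.2.unpair.1 x.unpair.2
  have succ3 : ComputableIn d fun n => n + 3 :=
    .of_computable (Primrec.nat_add.comp Primrec.id (Primrec.const 3)).to_comp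
  have hpos : ComputableIn d pos :=
    .pair (.pair (.const 5) (.pair .left (.const _))) (succ3.comp .right)
  have hneg : ComputableIn d neg :=
    .pair (.pair (.const 5) (.pair (.const _) .left)) (succ3.comp .right)
  have hpost : ComputableIn d post := by
    have primrec_left : Primrec fun n : ℕ => n.unpair.1 := Primrec.fst.comp Primrec.unpair
    have primrec_right : Primrec fun n : ℕ => n.unpair.2 := Primrec.snd.comp Primrec.unpair
    exact .of_computable (primrec_intervalCode (primrec_left.comp (primrec_left.comp primrec_left))
      (primrec_left.comp (primrec_right.comp primrec_left)) primrec_right).to_comp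
  refine ⟨_, RecursiveIn.comp hpost
    (((hR.comp_total hpos).pair (hR.comp_total hneg)).pair ComputableIn.right), ?_⟩
  intro φ hφ ε hε
  set e := Encodable.encode ε
  have h0 : Formula.IsSentence L .zero := Formula.isSentence_zero
  obtain ⟨m₁, hm₁, h₁⟩ := hspec _ (hφ.dotminus h0) (le_max_right _ _) (e + 3)
  obtain ⟨m₂, hm₂, h₂⟩ := hspec _ (h0.dotminus hφ) (le_max_right _ _) (e + 3)
  set i := m₁.unpair.1 with hi
  set j := m₂.unpair.1 with hj
  refine ⟨(((2 * i : ℕ) : ℚ) - (2 * j + 5 : ℕ)) / 2 ^ (e + 4),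
    (((2 * i + 5 : ℕ) : ℚ) - (2 * j : ℕ)) / 2 ^ (e + 4), ?_, ?_⟩
  · have hp : R (pos (Nat.pair φ.godel e)) = Part.some m₁ := by
      simpa only [pos, Nat.unpair_pair, Formula.godel] using hm₁
    have hn : R (neg (Nat.pair φ.godel e)) = Part.some m₂ := by
      simpa only [neg, Nat.unpair_pair, Formula.godel] using hm₂
    rw [← intervalCode_eq, hp, hn]
    simp [post, Seq.seq, hi, hj]
  · set δ : ℝ := (1 / 2 : ℝ) ^ (e + 3) with hδ
    have hhalf : (2 ^ (e + 4) : ℝ)⁻¹ = δ / 2 := by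
      rw [hδ, one_div, inv_pow, pow_succ 2 (e + 3), mul_inv]
      ring
    have hlen : 5 * δ < ε := by
      have he : (0 : ℝ) < e := by
        have : 0 < e := ε.pos.trans_le (Nat.right_le_pair _ _)
        exact_mod_cast this
      have h2 : (e : ℝ) < 2 ^ e := by exact_mod_cast Nat.lt_two_pow_self
      have hinv : (1 : ℝ) / e ≤ ε := by
        have := (Rat.cast_le (K := ℝ)).2 (inv_encode_le hε)
        push_cast at this
        exact this
      calc 5 * δ < 8 * δ := by linarith [show 0 < δ by positivity]
        _ = 1 / 2 ^ e := by rw [hδ, pow_add, one_div_pow]; ring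
        _ < 1 / e := one_div_lt_one_div_of_lt he h2
        _ ≤ ε := hinv
    have hsplit : S.sval φ = S.sval (.dotminus φ .zero) - S.sval (.dotminus .zero φ) := by
      rw [S.sval_dotminus, S.sval_dotminus, S.sval_zero, sub_zero, zero_sub, max_zero_sub_eq_self]
    rw [abs_le] at h₁ h₂
    push_cast
    simp only [div_eq_mul_inv, hhalf]
    have hδ0 : 0 < δ := by positivity
    refine ⟨?_, ?_, ?_⟩ <;> linarith

end CLPaper

namespace CLPaper

/-- Let `M` be an `L`-structure and `d` a Turing degree.  Then `Th(M)` is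
`d`-computable if and only if `⌜Th(M)⌝` is `Π₁^d`. -/
theorem thComputable_iff_thSet_pi1
    (L : CLang) (hL : L.IsComputable)
    (M : Type) [MetricSpace M] [Nonempty M] (S : CStruct M) (d : ℕ → Bool) :
    ThComputableIn d L S ↔ PiIn d 1 (thSet L S) := by
  exact ⟨fun h => h.piIn_thSet hL, fun h => h.thComputableIn⟩

end CLPaper
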